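/- arXiv:2508.20509 — 6 statements merged into one kernel-verified Lean document; each statement's English description precedes it below -/
import Mathlib

section
/- Let q be a power of an odd prime and let n, d be integers with 1 ≤ d ≤ n−1. Let 𝔅 be the set of n×n matrices over 𝔽_{q²} of block form [[B1, B2],[0, B3]] (row partition (d, n−d), column partition (n−d, d), so B1 is d×(n−d), B2 is d×d, B3 is (n−d)×d) satisfying B1 = −J_d·(B̄3)^t·J_{n−d} and B2 = −J_d·(B̄2)^t·J_d, and let 𝔄 be the set of n×n matrices over 𝔽_{q²} of block form [[A1, 0],[A2, A3]] (row partition (n−d, d), column partition (d, n−d), so A1 is (n−d)×d, A2 is d×d, A3 is d×(n−d)) satisfying A1 = −J_{n−d}·(Ā3)^t·J_d and A2 = −J_d·(Ā2)^t·J_d. Then the map 𝔅 × 𝔄 → 𝔽_q, (B, A) ↦ tr(B·A) + (tr(B·A))^q, is an 𝔽_q-bilinear perfect pairing: if B ∈ 𝔅 satisfies tr(B·A) + (tr(B·A))^q = 0 for all A ∈ 𝔄 then B = 0, and if A ∈ 𝔄 satisfies tr(B·A) + (tr(B·A))^q = 0 for all B ∈ 𝔅 then A = 0. -/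
open Matrix

/-- The `m × m` matrix with `1`'s on the antidiagonal and `0`'s elsewhere. -/
def antidiagMat (F : Type) [Zero F] [One F] (m : ℕ) : Matrix (Fin m) (Fin m) F :=
  Matrix.of fun i j => if (i : ℕ) + (j : ℕ) = m - 1 then 1 else 0

/-- The matrix `J * (conjugate transpose of M) * J`, the conjugation being given by `σ`. -/
def antidiagAdjoint {F : Type} [Field F] (σ : F →+* F) {a b : ℕ} (M : Matrix (Fin a) (Fin b) F) :
    Matrix (Fin b) (Fin a) F :=
  antidiagMat F b * (M.map σ)ᵀ * antidiagMat F a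

section AntidiagAdjoint

variable {F : Type} [Field F]

theorem antidiagMat_mul_self (m : ℕ) : antidiagMat F m * antidiagMat F m = 1 := by
  ext i j
  rw [Matrix.mul_apply, Finset.sum_eq_single i.rev]
  · have h : (i : ℕ) + (i.rev : ℕ) = m - 1 := by rw [Fin.val_rev]; omega
    simp only [antidiagMat, Matrix.of_apply, h, if_true, one_mul, Matrix.one_apply, Fin.ext_iff]
    refine if_congr ?_ rfl rfl
    omega
  · intro l _ hl
    have h : (i : ℕ) + (l : ℕ) ≠ m - 1 := by
      intro h
      apply hl
      rw [Fin.ext_iff, Fin.val_rev]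
      omega
    simp [antidiagMat, h]
  · simp

theorem antidiagMat_transpose (m : ℕ) : (antidiagMat F m)ᵀ = antidiagMat F m := by
  ext i j
  simp [antidiagMat, add_comm]

theorem antidiagMat_map (σ : F →+* F) (m : ℕ) : (antidiagMat F m).map σ = antidiagMat F m := by
  ext i j
  simp [antidiagMat, apply_ite σ]

variable (σ : F →+* F) {a b c : ℕ}

theorem antidiagAdjoint_zero : antidiagAdjoint σ (0 : Matrix (Fin a) (Fin b) F) = 0 := by
  simp [antidiagAdjoint]

theorem antidiagAdjoint_sub (M N : Matrix (Fin a) (Fin b) F) :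
    antidiagAdjoint σ (M - N) = antidiagAdjoint σ M - antidiagAdjoint σ N := by
  simp [antidiagAdjoint, Matrix.map_sub, Matrix.mul_sub, Matrix.sub_mul]

theorem antidiagAdjoint_antidiagAdjoint (hσ : ∀ x, σ (σ x) = x) (M : Matrix (Fin a) (Fin b) F) :
    antidiagAdjoint σ (antidiagAdjoint σ M) = M := by
  have h : (M.map σ).map σ = M := by
    ext i j
    simp [hσ]
  simp only [antidiagAdjoint, Matrix.map_mul, Matrix.transpose_mul, antidiagMat_map,
    antidiagMat_transpose, Matrix.transpose_map, Matrix.transpose_transpose, h]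
  rw [← Matrix.mul_assoc, ← Matrix.mul_assoc, antidiagMat_mul_self, Matrix.one_mul,
    Matrix.mul_assoc, antidiagMat_mul_self, Matrix.mul_one]

theorem trace_antidiagAdjoint_mul_antidiagAdjoint (M : Matrix (Fin a) (Fin b) F)
    (N : Matrix (Fin b) (Fin a) F) :
    (antidiagAdjoint σ M * antidiagAdjoint σ N).trace = σ (M * N).trace := by
  have h : antidiagAdjoint σ M * antidiagAdjoint σ N =
      antidiagMat F b * (((N * M).map σ)ᵀ * antidiagMat F b) := by
    simp only [antidiagAdjoint, Matrix.map_mul, Matrix.transpose_mul, Matrix.mul_assoc]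
    rw [← Matrix.mul_assoc (antidiagMat F a) (antidiagMat F a), antidiagMat_mul_self,
      Matrix.one_mul]
  rw [h, Matrix.trace_mul_comm, Matrix.mul_assoc, antidiagMat_mul_self, Matrix.mul_one,
    Matrix.trace_transpose, Matrix.trace_mul_comm M N]
  exact (AddMonoidHom.map_trace σ.toAddMonoidHom _).symm

variable {σ}

/-- The Hermitian trace form `tr (M * X) + σ (tr (M * X))` is nondegenerate. -/
theorem eq_zero_of_trace_mul_add_conj_eq_zero (h2 : (2 : F) ≠ 0) {M : Matrix (Fin a) (Fin b) F}
    (h : ∀ X : Matrix (Fin b) (Fin a) F, (M * X).trace + σ (M * X).trace = 0) : M = 0 := by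
  ext i j
  by_contra hM
  have hij := h (Matrix.single j i (M i j)⁻¹)
  rw [Matrix.trace_mul_single] at hij
  have h1 : M i j * (M i j)⁻¹ = 1 := mul_inv_cancel₀ hM
  simp only [h1, MulOpposite.smul_eq_mul_unop, MulOpposite.unop_op, map_one] at hij
  exact h2 (by rw [← one_add_one_eq_two, hij])

/-- Skew-adjoint data are detected by the symmetrised trace pairing. -/
theorem eq_zero_of_skew_trace_pairing_eq_zero (hσ : ∀ x, σ (σ x) = x) (h2 : (2 : F) ≠ 0)
    {B1 : Matrix (Fin a) (Fin b) F} {B2 : Matrix (Fin c) (Fin c) F}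
    {B3 : Matrix (Fin b) (Fin a) F}
    (hB1 : B1 = -antidiagAdjoint σ B3) (hB2 : B2 = -antidiagAdjoint σ B2)
    (h : ∀ (A1 : Matrix (Fin b) (Fin a) F) (A2 : Matrix (Fin c) (Fin c) F)
      (A3 : Matrix (Fin a) (Fin b) F),
      A1 = -antidiagAdjoint σ A3 → A2 = -antidiagAdjoint σ A2 →
      ((B1 * A1).trace + (B2 * A2).trace + (B3 * A3).trace) +
        σ ((B1 * A1).trace + (B2 * A2).trace + (B3 * A3).trace) = 0) :
    B1 = 0 ∧ B2 = 0 ∧ B3 = 0 := by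
  have double : ∀ x : F, x + x = 0 → x = 0 := fun x hx => by
    rw [← two_mul] at hx
    exact (mul_eq_zero.mp hx).resolve_left h2
  have h3 : B3 = 0 := by
    refine eq_zero_of_trace_mul_add_conj_eq_zero (σ := σ) h2 fun X => double _ ?_
    have hX := h _ 0 X rfl (by simp [antidiagAdjoint_zero])
    rw [hB1, Matrix.neg_mul, Matrix.mul_neg, neg_neg, trace_antidiagAdjoint_mul_antidiagAdjoint] at hX
    simp only [Matrix.mul_zero, Matrix.trace_zero, map_add, hσ, map_zero] at hX
    linear_combination hX
  have h2' : B2 = 0 := by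
    refine eq_zero_of_trace_mul_add_conj_eq_zero (σ := σ) h2 fun X => double _ ?_
    have hX := h 0 (X - antidiagAdjoint σ X) 0 (by simp [antidiagAdjoint_zero])
      (by rw [antidiagAdjoint_sub, antidiagAdjoint_antidiagAdjoint σ hσ, neg_sub])
    have hadj : (B2 * antidiagAdjoint σ X).trace = -σ (B2 * X).trace := by
      rw [← trace_antidiagAdjoint_mul_antidiagAdjoint, ← Matrix.trace_neg, ← Matrix.neg_mul, ← hB2]
    simp only [Matrix.mul_zero, Matrix.trace_zero, Matrix.mul_sub, Matrix.trace_sub, hadj,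
      map_add, map_sub, map_neg, hσ, map_zero] at hX
    linear_combination hX
  refine ⟨?_, h2', h3⟩
  rw [hB1, h3, antidiagAdjoint_zero, neg_zero]

end AntidiagAdjoint

theorem trace_fromBlocks_mul_fromBlocks {R l m n o : Type*} [CommRing R] [Fintype l] [Fintype m]
    [Fintype n] [Fintype o] (B1 : Matrix l m R) (B2 : Matrix l n R) (B3 : Matrix o n R)
    (A1 : Matrix m l R) (A2 : Matrix n l R) (A3 : Matrix n o R) :
    (Matrix.fromBlocks B1 B2 0 B3 * Matrix.fromBlocks A1 0 A2 A3).trace =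
      (B1 * A1).trace + (B2 * A2).trace + (B3 * A3).trace := by
  simp [Matrix.fromBlocks_multiply, Matrix.trace, Finset.sum_add_distrib]

/-- For `q` a power of an odd prime and `1 ≤ d ≤ n−1`, the map
`𝔅 × 𝔄 → 𝔽_q`, `(B, A) ↦ tr(B·A) + tr(B·A)^q` is a perfect pairing. -/
theorem unitary_trace_pairing_perfect
    (p k q : ℕ) (hp : p.Prime) (hpodd : Odd p) (hk : 1 ≤ k) (hq : q = p ^ k)
    (F : Type) [Field F] [Fintype F] (hF : Fintype.card F = q ^ 2)
    (n d : ℕ) (hd : 1 ≤ d) (hdn : d ≤ n - 1) :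
    -- the pairing takes values in 𝔽_q (the fixed field of x ↦ x^q)
    (∀ (B1 : Matrix (Fin d) (Fin (n - d)) F) (B2 : Matrix (Fin d) (Fin d) F)
        (B3 : Matrix (Fin (n - d)) (Fin d) F),
      B1 = -(antidiagMat F d) * (B3.map (fun x => x ^ q))ᵀ * antidiagMat F (n - d) →
      B2 = -(antidiagMat F d) * (B2.map (fun x => x ^ q))ᵀ * antidiagMat F d →
      ∀ (A1 : Matrix (Fin (n - d)) (Fin d) F) (A2 : Matrix (Fin d) (Fin d) F)
        (A3 : Matrix (Fin d) (Fin (n - d)) F),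
        A1 = -(antidiagMat F (n - d)) * (A3.map (fun x => x ^ q))ᵀ * antidiagMat F d →
        A2 = -(antidiagMat F d) * (A2.map (fun x => x ^ q))ᵀ * antidiagMat F d →
        (Matrix.trace (Matrix.fromBlocks B1 B2 0 B3 * Matrix.fromBlocks A1 0 A2 A3) +
          (Matrix.trace (Matrix.fromBlocks B1 B2 0 B3 * Matrix.fromBlocks A1 0 A2 A3)) ^ q) ^ q =
        Matrix.trace (Matrix.fromBlocks B1 B2 0 B3 * Matrix.fromBlocks A1 0 A2 A3) +
          (Matrix.trace (Matrix.fromBlocks B1 B2 0 B3 * Matrix.fromBlocks A1 0 A2 A3)) ^ q) ∧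
    -- nondegeneracy in the first variable
    (∀ (B1 : Matrix (Fin d) (Fin (n - d)) F) (B2 : Matrix (Fin d) (Fin d) F)
        (B3 : Matrix (Fin (n - d)) (Fin d) F),
      B1 = -(antidiagMat F d) * (B3.map (fun x => x ^ q))ᵀ * antidiagMat F (n - d) →
      B2 = -(antidiagMat F d) * (B2.map (fun x => x ^ q))ᵀ * antidiagMat F d →
      (∀ (A1 : Matrix (Fin (n - d)) (Fin d) F) (A2 : Matrix (Fin d) (Fin d) F)
          (A3 : Matrix (Fin d) (Fin (n - d)) F),
        A1 = -(antidiagMat F (n - d)) * (A3.map (fun x => x ^ q))ᵀ * antidiagMat F d →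
        A2 = -(antidiagMat F d) * (A2.map (fun x => x ^ q))ᵀ * antidiagMat F d →
        Matrix.trace (Matrix.fromBlocks B1 B2 0 B3 * Matrix.fromBlocks A1 0 A2 A3) +
          (Matrix.trace (Matrix.fromBlocks B1 B2 0 B3 * Matrix.fromBlocks A1 0 A2 A3)) ^ q = 0) →
      B1 = 0 ∧ B2 = 0 ∧ B3 = 0) ∧
    -- nondegeneracy in the second variable
    (∀ (A1 : Matrix (Fin (n - d)) (Fin d) F) (A2 : Matrix (Fin d) (Fin d) F)
        (A3 : Matrix (Fin d) (Fin (n - d)) F),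
      A1 = -(antidiagMat F (n - d)) * (A3.map (fun x => x ^ q))ᵀ * antidiagMat F d →
      A2 = -(antidiagMat F d) * (A2.map (fun x => x ^ q))ᵀ * antidiagMat F d →
      (∀ (B1 : Matrix (Fin d) (Fin (n - d)) F) (B2 : Matrix (Fin d) (Fin d) F)
          (B3 : Matrix (Fin (n - d)) (Fin d) F),
        B1 = -(antidiagMat F d) * (B3.map (fun x => x ^ q))ᵀ * antidiagMat F (n - d) →
        B2 = -(antidiagMat F d) * (B2.map (fun x => x ^ q))ᵀ * antidiagMat F d →
        Matrix.trace (Matrix.fromBlocks B1 B2 0 B3 * Matrix.fromBlocks A1 0 A2 A3) +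
          (Matrix.trace (Matrix.fromBlocks B1 B2 0 B3 * Matrix.fromBlocks A1 0 A2 A3)) ^ q = 0) →
      A1 = 0 ∧ A2 = 0 ∧ A3 = 0) := by
  subst hq
  have : Fact p.Prime := ⟨hp⟩
  have : CharP F p := charP_of_card_eq_prime_pow (f := k * 2) (by rw [hF, pow_mul])
  have h2 : (2 : F) ≠ 0 := by
    intro h
    have hdvd : p ∣ 2 := (CharP.cast_eq_zero_iff F p 2).mp (by exact_mod_cast h)
    rw [(Nat.prime_dvd_prime_iff_eq hp Nat.prime_two).mp hdvd] at hpodd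
    exact absurd hpodd (by decide)
  have hpow : ∀ x : F, x ^ p ^ k = iterateFrobenius F p k x := fun x => rfl
  have hσ : ∀ x : F, iterateFrobenius F p k (iterateFrobenius F p k x) = x := fun x => by
    rw [← hpow, ← hpow, ← pow_mul, ← sq, ← hF, FiniteField.pow_card]
  have hadj : ∀ {a b : ℕ} (M : Matrix (Fin a) (Fin b) F),
      -(antidiagMat F b) * (M.map fun x => x ^ p ^ k)ᵀ * antidiagMat F a =
        -antidiagAdjoint (iterateFrobenius F p k) M := fun M => by
    rw [Matrix.neg_mul, Matrix.neg_mul]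
    rfl
  simp only [hadj, trace_fromBlocks_mul_fromBlocks]
  simp only [hpow]
  refine ⟨?_, ?_, ?_⟩
  · intro B1 B2 B3 _ _ A1 A2 A3 _ _
    rw [map_add (iterateFrobenius F p k) _ (iterateFrobenius F p k _), hσ, add_comm]
  · intro B1 B2 B3 hB1 hB2 h
    exact eq_zero_of_skew_trace_pairing_eq_zero hσ h2 hB1 hB2 h
  · intro A1 A2 A3 hA1 hA2 h
    refine eq_zero_of_skew_trace_pairing_eq_zero hσ h2 hA1 hA2 fun B1 B2 B3 hB1 hB2 => ?_
    rw [Matrix.trace_mul_comm A1, Matrix.trace_mul_comm A2, Matrix.trace_mul_comm A3]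
    exact h B1 B2 B3 hB1 hB2
end

section
/- Let q be a power of an odd prime and let N(n, r) denote the number of symmetric n×n matrices over 𝔽_q of rank r. Then for integers s with 0 ≤ 2s ≤ n, N(n, 2s) = ∏_{i=1}^{s} q^{2i}/(q^{2i}−1) · ∏_{i=0}^{2s−1} (q^{n−i}−1), and for integers s with 0 ≤ 2s+1 ≤ n, N(n, 2s+1) = ∏_{i=1}^{s} q^{2i}/(q^{2i}−1) · ∏_{i=0}^{2s} (q^{n−i}−1) (equalities of rational numbers). -/
open Matrix Finset

namespace Matrix

section Bordered

variable {α ι : Type*}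

/-- The square matrix obtained from `M` by appending `v` as last row and as last column, with
corner entry `a`. -/
def bordered (M : Matrix ι ι α) (v : ι → α) (a : α) : Matrix (ι ⊕ Unit) (ι ⊕ Unit) α :=
  fromBlocks M (replicateCol Unit v) (replicateRow Unit v) (of fun _ _ => a)

lemma isSymm_bordered {M : Matrix ι ι α} (hM : M.IsSymm) (v : ι → α) (a : α) :
    (bordered M v a).IsSymm :=
  hM.fromBlocks rfl rfl

lemma bordered_eq_fromCols (M : Matrix ι ι α) (v : ι → α) (a : α) :
    bordered M v a = fromCols (fromCols Mᵀ (replicateCol Unit v))ᵀ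
      (replicateCol Unit (Sum.elim v fun _ => a)) := by
  ext (i | i) (j | j) <;> simp [bordered]

/-- A symmetric matrix with one more row and column is a bordered symmetric matrix. -/
def symmEquivBordered :
    {A : Matrix (ι ⊕ Unit) (ι ⊕ Unit) α // A.IsSymm} ≃
      {M : Matrix ι ι α // M.IsSymm} × (ι → α) × α where
  toFun A := (⟨A.1.toBlocks₁₁, A.2.submatrix Sum.inl⟩,
    fun i => A.1 (Sum.inl i) (Sum.inr ()), A.1 (Sum.inr ()) (Sum.inr ()))
  invFun x := ⟨bordered x.1.1 x.2.1 x.2.2, isSymm_bordered x.1.2 _ _⟩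
  left_inv A := by
    ext (i | i) (j | j) <;> simp [bordered, toBlocks₁₁, A.2.apply]
  right_inv x := rfl

end Bordered

variable {F ι κ : Type*} [Field F] [Fintype ι]

lemma range_mulVecLin_fromCols_replicateCol (M : Matrix κ ι F) (v : κ → F) :
    LinearMap.range (fromCols M (replicateCol Unit v)).mulVecLin =
      LinearMap.range M.mulVecLin ⊔ Submodule.span F {v} := by
  have hcol : (fromCols M (replicateCol Unit v)).col = Sum.elim M.col fun _ => v := by
    ext (_ | _) _ <;> rfl
  rw [range_mulVecLin, range_mulVecLin, hcol, Set.Sum.elim_range, Submodule.span_union,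
    Set.range_const]

lemma rank_fromCols_replicateCol_of_mem [Finite κ] {M : Matrix κ ι F} {v : κ → F}
    (h : ∃ w, M *ᵥ w = v) : (fromCols M (replicateCol Unit v)).rank = M.rank := by
  rw [rank, range_mulVecLin_fromCols_replicateCol, sup_eq_left.2, rank]
  simpa [Submodule.span_le] using h

lemma rank_fromCols_replicateCol_of_notMem [Finite κ] {M : Matrix κ ι F} {v : κ → F}
    (h : ¬ ∃ w, M *ᵥ w = v) : (fromCols M (replicateCol Unit v)).rank = M.rank + 1 := by
  rw [rank, range_mulVecLin_fromCols_replicateCol, Submodule.finrank_sup_span_singleton, rank]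
  simpa using h

lemma exists_transpose_fromCols_mulVec_eq_iff (M : Matrix ι ι F) (v : ι → F) (a : F) :
    (∃ w, (fromCols Mᵀ (replicateCol Unit v))ᵀ *ᵥ w = Sum.elim v fun _ => a) ↔
      ∃ w, M *ᵥ w = v ∧ v ⬝ᵥ w = a := by
  refine exists_congr fun w => ?_
  rw [transpose_fromCols, transpose_transpose, fromRows_mulVec, Sum.elim_eq_iff]
  simp [funext_iff, mulVec, replicateCol]

lemma rank_bordered_of_notMem {M : Matrix ι ι F} (hM : M.IsSymm) {v : ι → F} (a : F)
    (h : ¬ ∃ w, M *ᵥ w = v) : (bordered M v a).rank = M.rank + 2 := by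
  rw [bordered_eq_fromCols, rank_fromCols_replicateCol_of_notMem, rank_transpose,
    rank_fromCols_replicateCol_of_notMem, rank_transpose]
  · rwa [hM.eq]
  · rw [exists_transpose_fromCols_mulVec_eq_iff]
    exact fun ⟨w, hw, _⟩ => h ⟨w, hw⟩

lemma rank_bordered_mulVec {M : Matrix ι ι F} (hM : M.IsSymm) (w : ι → F) (a : F)
    [Decidable (a = (M *ᵥ w) ⬝ᵥ w)] :
    (bordered M (M *ᵥ w) a).rank = if a = (M *ᵥ w) ⬝ᵥ w then M.rank else M.rank + 1 := by
  have hcol : ∃ u, Mᵀ *ᵥ u = M *ᵥ w := ⟨w, by rw [hM.eq]⟩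
  split_ifs with ha
  · rw [bordered_eq_fromCols, rank_fromCols_replicateCol_of_mem, rank_transpose,
      rank_fromCols_replicateCol_of_mem hcol, rank_transpose]
    rw [exists_transpose_fromCols_mulVec_eq_iff]
    exact ⟨w, rfl, ha.symm⟩
  · rw [bordered_eq_fromCols, rank_fromCols_replicateCol_of_notMem, rank_transpose,
      rank_fromCols_replicateCol_of_mem hcol, rank_transpose]
    rw [exists_transpose_fromCols_mulVec_eq_iff]
    rintro ⟨u, hu, rfl⟩
    apply ha
    have key : ∀ x y : ι → F, (M *ᵥ x) ⬝ᵥ y = x ⬝ᵥ (M *ᵥ y) := fun x y => by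
      rw [dotProduct_mulVec, ← mulVec_transpose, hM.eq]
    rw [key, hu, dotProduct_comm]

open Classical in
lemma card_fiber_bordered [Fintype F] {M : Matrix ι ι F} (hM : M.IsSymm) (r : ℕ) :
    (Nat.card {x : (ι → F) × F // (bordered M x.1 x.2).rank = r} : ℚ) =
      (if M.rank = r then (Fintype.card F : ℚ) ^ M.rank else 0) +
      (if M.rank + 1 = r then ((Fintype.card F : ℚ) - 1) * (Fintype.card F : ℚ) ^ M.rank else 0) +
      (if M.rank + 2 = r then
        (Fintype.card F : ℚ) ^ (Fintype.card ι + 1) - (Fintype.card F : ℚ) ^ (M.rank + 1)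
        else 0) := by
  set q : ℚ := (Fintype.card F : ℚ) with hq
  have hcorner : ∀ v : ι → F,
      ∑ a : F, (if (bordered M v a).rank = r then (1 : ℚ) else 0) =
        if ∃ w, M *ᵥ w = v then
          (if M.rank = r then 1 else 0) + (if M.rank + 1 = r then q - 1 else 0)
        else (if M.rank + 2 = r then q else 0) := by
    intro v
    by_cases hv : ∃ w, M *ᵥ w = v
    · rw [if_pos hv]
      obtain ⟨w, rfl⟩ := hv
      simp only [rank_bordered_mulVec hM]
      rw [← Finset.add_sum_erase _ _ (Finset.mem_univ ((M *ᵥ w) ⬝ᵥ w)),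
        Finset.sum_congr rfl (g := fun _ => if M.rank + 1 = r then (1 : ℚ) else 0)]
      · simp [Finset.card_erase_of_mem, Nat.cast_sub Fintype.card_pos, ← hq]
      · intro a ha
        rw [if_neg (Finset.ne_of_mem_erase ha)]
    · rw [if_neg hv]
      simp [rank_bordered_of_notMem hM _ hv, ← hq]
  have hrange : ((univ.filter fun v : ι → F => ∃ w, M *ᵥ w = v).card : ℚ) = q ^ M.rank := by
    have h := Module.card_eq_pow_finrank (K := F) (V := LinearMap.range M.mulVecLin)
    rw [← Nat.card_eq_fintype_card, ← rank] at h
    rw [hq, ← Nat.cast_pow, ← h, ← Fintype.card_subtype, ← Nat.card_eq_fintype_card]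
    rfl
  have hcompl : ((univ.filter fun v : ι → F => ¬ ∃ w, M *ᵥ w = v).card : ℚ) =
      q ^ Fintype.card ι - q ^ M.rank := by
    rw [eq_sub_iff_add_eq', ← hrange, ← Nat.cast_add, Finset.card_filter_add_card_filter_not]
    simp [hq]
  rw [Nat.card_eq_fintype_card, Fintype.card_subtype, Finset.card_filter]
  push_cast
  rw [Fintype.sum_prod_type]
  simp only [hcorner]
  rw [Finset.sum_ite, Finset.sum_const, Finset.sum_const, nsmul_eq_mul, nsmul_eq_mul, hrange,
    hcompl]
  split_ifs <;> ring

end Matrix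

/-- The number of symmetric `n × n` matrices of rank `r` over `F`. -/
noncomputable def symmRankCount (F : Type*) [Field F] (n r : ℕ) : ℕ :=
  Nat.card {M : Matrix (Fin n) (Fin n) F // M.IsSymm ∧ M.rank = r}

section Count

variable (F : Type*) [Field F] [Fintype F]

open Classical in
lemma symmRankCount_eq_sum (n r : ℕ) :
    (symmRankCount F n r : ℚ) =
      ∑ M : {M : Matrix (Fin n) (Fin n) F // M.IsSymm}, if M.1.rank = r then 1 else 0 := by
  rw [symmRankCount, ← Nat.card_congr (Equiv.subtypeSubtypeEquivSubtypeInter _ _),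
    Nat.card_eq_fintype_card, Fintype.card_subtype, Finset.card_filter]
  push_cast
  rfl

open Classical in
lemma symmRankCount_succ_eq_sum (n r : ℕ) :
    (symmRankCount F (n + 1) r : ℚ) =
      ∑ M : {M : Matrix (Fin n) (Fin n) F // M.IsSymm},
        (Nat.card {x : (Fin n → F) × F // (bordered M.1 x.1 x.2).rank = r} : ℚ) := by
  let e : Fin n ⊕ Unit ≃ Fin (n + 1) :=
    (Equiv.sumCongr (.refl _) (.ofUnique _ _)).trans finSumFinEquiv
  have e₁ : {M : Matrix (Fin (n + 1)) (Fin (n + 1)) F // M.IsSymm ∧ M.rank = r} ≃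
      {A : Matrix (Fin n ⊕ Unit) (Fin n ⊕ Unit) F // A.IsSymm ∧ A.rank = r} :=
    ((reindex e e).subtypeEquiv fun A => by rw [isSymm_reindex_iff, rank_reindex]).symm
  have e₂ : {A : {A : Matrix (Fin n ⊕ Unit) (Fin n ⊕ Unit) F // A.IsSymm} // A.1.rank = r} ≃
      {x : {M : Matrix (Fin n) (Fin n) F // M.IsSymm} × (Fin n → F) × F //
        (bordered x.1.1 x.2.1 x.2.2).rank = r} :=
    (symmEquivBordered.symm.subtypeEquiv fun _ => Iff.rfl).symm
  have e₃ := Equiv.subtypeProdEquivSigmaSubtype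
    fun (M : {M : Matrix (Fin n) (Fin n) F // M.IsSymm}) (x : (Fin n → F) × F) =>
      (bordered M.1 x.1 x.2).rank = r
  rw [symmRankCount, Nat.card_congr (e₁.trans
    ((Equiv.subtypeSubtypeEquivSubtypeInter _ _).symm.trans (e₂.trans e₃))),
    Nat.card_sigma, Nat.cast_sum]

lemma symmRankCount_succ_zero (n : ℕ) :
    (symmRankCount F (n + 1) 0 : ℚ) = symmRankCount F n 0 := by
  rw [symmRankCount_succ_eq_sum, symmRankCount_eq_sum]
  refine Finset.sum_congr rfl fun M _ => ?_
  rw [card_fiber_bordered M.2]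
  split_ifs <;> simp_all

lemma symmRankCount_succ_one (n : ℕ) :
    (symmRankCount F (n + 1) 1 : ℚ) = Fintype.card F * symmRankCount F n 1 +
      (Fintype.card F - 1) * symmRankCount F n 0 := by
  rw [symmRankCount_succ_eq_sum, symmRankCount_eq_sum, symmRankCount_eq_sum, Finset.mul_sum,
    Finset.mul_sum, ← Finset.sum_add_distrib]
  refine Finset.sum_congr rfl fun M _ => ?_
  rw [card_fiber_bordered M.2]
  split_ifs <;> first | omega | simp_all

/-- MacWilliams' recurrence. -/
lemma symmRankCount_succ_add_two (n r : ℕ) :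
    (symmRankCount F (n + 1) (r + 2) : ℚ) =
      (Fintype.card F : ℚ) ^ (r + 2) * symmRankCount F n (r + 2) +
      (Fintype.card F - 1) * (Fintype.card F : ℚ) ^ (r + 1) * symmRankCount F n (r + 1) +
      ((Fintype.card F : ℚ) ^ (n + 1) - (Fintype.card F : ℚ) ^ (r + 1)) *
        symmRankCount F n r := by
  rw [symmRankCount_succ_eq_sum]
  simp only [symmRankCount_eq_sum]
  rw [Finset.mul_sum, Finset.mul_sum, Finset.mul_sum, ← Finset.sum_add_distrib,
    ← Finset.sum_add_distrib]
  refine Finset.sum_congr rfl fun M _ => ?_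
  rw [card_fiber_bordered M.2]
  split_ifs <;> first | omega | simp_all

lemma symmRankCount_zero (r : ℕ) : symmRankCount F 0 r = if r = 0 then 1 else 0 := by
  have hrank (M : Matrix (Fin 0) (Fin 0) F) : M.rank = 0 := by
    simpa using M.rank_le_width
  have hsymm (M : Matrix (Fin 0) (Fin 0) F) : M.IsSymm := Subsingleton.elim _ _
  split_ifs with h
  · rw [symmRankCount, Nat.card_eq_one_iff_unique]
    exact ⟨inferInstance, ⟨0, hsymm 0, by rw [hrank, h]⟩⟩
  · simp [symmRankCount, hrank, hsymm, Ne.symm h]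

end Count

/-- `∏_{i < r} (q^(n-i) - 1)`, with the exponent of `q` an integer. -/
def descProd (q : ℚ) (n r : ℕ) : ℚ := ∏ i ∈ range r, (q ^ n / q ^ i - 1)

lemma descProd_eq {q : ℚ} (hq : q ≠ 0) {n r : ℕ} (h : r ≤ n) :
    descProd q n r = ∏ i ∈ range r, (q ^ (n - i) - 1) := by
  refine Finset.prod_congr rfl fun i hi => ?_
  rw [pow_sub₀ _ hq ((Finset.mem_range.1 hi).le.trans h), div_eq_mul_inv]

lemma descProd_succ (q : ℚ) (n r : ℕ) :
    descProd q n (r + 1) = descProd q n r * (q ^ n / q ^ r - 1) :=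
  Finset.prod_range_succ _ _

lemma descProd_succ_succ {q : ℚ} (hq : q ≠ 0) (n r : ℕ) :
    descProd q (n + 1) (r + 1) = descProd q n r * (q ^ (n + 1) - 1) := by
  rw [descProd, Finset.prod_range_succ', descProd]
  congr 1
  · refine Finset.prod_congr rfl fun i _ => ?_
    rw [pow_succ, pow_succ, mul_div_mul_right _ _ hq]
  · simp

/-- The factor `∏_{i=1}^{s} q^(2i) / (q^(2i) - 1)`. -/
def evenFactor (q : ℚ) (s : ℕ) : ℚ := ∏ i ∈ Icc 1 s, (q ^ (2 * i) / (q ^ (2 * i) - 1))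

lemma evenFactor_succ (q : ℚ) (s : ℕ) :
    evenFactor q (s + 1) = evenFactor q s * (q ^ (2 * s + 2) / (q ^ (2 * s + 2) - 1)) :=
  Finset.prod_Icc_succ_top (by omega) _

lemma symmRankCount_eq (F : Type*) [Field F] [Fintype F] (n : ℕ) :
    ∀ s, (symmRankCount F n (2 * s) : ℚ) =
        evenFactor (Fintype.card F) s * descProd (Fintype.card F) n (2 * s) ∧
      (symmRankCount F n (2 * s + 1) : ℚ) =
        evenFactor (Fintype.card F) s * descProd (Fintype.card F) n (2 * s + 1) := by
  have hone : (1 : ℚ) < Fintype.card F := by exact_mod_cast Fintype.one_lt_card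
  have hcard : (Fintype.card F : ℚ) ≠ 0 := by positivity
  induction n with
  | zero =>
    intro s
    have hvanish (r : ℕ) : descProd (Fintype.card F) 0 (r + 1) = 0 := by
      simp [descProd, Finset.prod_range_succ']
    rw [symmRankCount_zero, symmRankCount_zero, hvanish]
    cases s with
    | zero => simp [evenFactor, descProd]
    | succ s => simp [Nat.mul_succ, hvanish]
  | succ n ih =>
    intro s
    cases s with
    | zero =>
      have h₀ := (ih 0).1
      have h₁ := (ih 0).2
      simp only [evenFactor, descProd, mul_zero, zero_add] at h₀ h₁ ⊢
      rw [symmRankCount_succ_zero, symmRankCount_succ_one, h₀, h₁]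
      simp
      ring
    | succ s =>
      have h₀ := ih s
      have h₁ := ih (s + 1)
      set q : ℚ := (Fintype.card F : ℚ)
      have hden : q ^ (2 * s + 2) - 1 ≠ 0 :=
        (sub_pos.2 (one_lt_pow₀ hone (by omega))).ne'
      simp only [Nat.mul_succ] at h₁ ⊢
      constructor
      · rw [symmRankCount_succ_add_two, h₁.1, h₀.2, h₀.1, evenFactor_succ,
          descProd_succ_succ hcard, descProd_succ q n (2 * s + 1), descProd_succ]
        field_simp
        ring
      · rw [show 2 * s + 2 + 1 = (2 * s + 1) + 2 by ring, symmRankCount_succ_add_two,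
          show 2 * s + 1 + 2 = 2 * s + 2 + 1 by ring, h₁.2, h₁.1, h₀.2, evenFactor_succ,
          descProd_succ_succ hcard, descProd_succ q n (2 * s + 2), descProd_succ q n (2 * s + 1)]
        field_simp
        ring

/-- MacWilliams' count of symmetric `n×n` matrices over `𝔽_q` of rank `2s`
and of rank `2s+1`. -/
theorem card_symmetric_matrices_rank
    (p k q : ℕ) (hp : p.Prime) (hpodd : Odd p) (hk : 1 ≤ k) (hq : q = p ^ k)
    (F : Type) [Field F] [Fintype F] (hF : Fintype.card F = q)
    (n : ℕ) :
    (∀ s : ℕ, 2 * s ≤ n →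
      (Nat.card {M : Matrix (Fin n) (Fin n) F | Mᵀ = M ∧ M.rank = 2 * s} : ℚ) =
        (∏ i ∈ Finset.Icc 1 s, ((q : ℚ) ^ (2 * i) / ((q : ℚ) ^ (2 * i) - 1))) *
          ∏ i ∈ Finset.range (2 * s), ((q : ℚ) ^ (n - i) - 1)) ∧
    (∀ s : ℕ, 2 * s + 1 ≤ n →
      (Nat.card {M : Matrix (Fin n) (Fin n) F | Mᵀ = M ∧ M.rank = 2 * s + 1} : ℚ) =
        (∏ i ∈ Finset.Icc 1 s, ((q : ℚ) ^ (2 * i) / ((q : ℚ) ^ (2 * i) - 1))) *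
          ∏ i ∈ Finset.range (2 * s + 1), ((q : ℚ) ^ (n - i) - 1)) := by
  have hcard : (q : ℚ) = Fintype.card F := by rw [hF]
  have hne : (q : ℚ) ≠ 0 := by
    rw [hcard]
    exact_mod_cast Fintype.card_ne_zero
  refine ⟨fun s hs => ?_, fun s hs => ?_⟩
  · rw [← descProd_eq hne hs, hcard]
    exact (symmRankCount_eq F n s).1
  · rw [← descProd_eq hne hs, hcard]
    exact (symmRankCount_eq F n s).2
end

section
/- Let q be a power of an odd prime and let C be an n×n skew-Hermitian matrix over 𝔽_{q²} (i.e. (C̄)^t = −C) of rank r. Then there exist an invertible matrix A ∈ GL_n(𝔽_{q²}) and a scalar α ∈ 𝔽_{q²} with α ≠ 0 and α + α^q = 0 such that A·C·(Ā)^t = α·[[I_r, 0],[0, 0]]. -/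
open Matrix

section SkewHermitian

variable {F ι : Type*} [Field F] [StarRing F] [Fintype ι]

/-- A non-isotropic vector of a skew-Hermitian matrix can be rescaled to take the value `α`. -/
theorem exists_eq_of_anisotropic {α : F} (hstar : star α = -α)
    (hnorm : ∀ c : F, star c = c → ∃ x, x * star x = c)
    {C : Matrix ι ι F} (hC : Cᴴ = -C) {v : ι → F} (hv : v ⬝ᵥ C *ᵥ star v ≠ 0) :
    ∃ x : F, (x • v) ⬝ᵥ C *ᵥ star (x • v) = α := by
  have hs : star (v ⬝ᵥ C *ᵥ star v) = -(v ⬝ᵥ C *ᵥ star v) := by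
    rw [← Matrix.star_dotProduct_star, Matrix.star_mulVec, star_star, hC, Matrix.vecMul_neg,
      neg_dotProduct, Matrix.dotProduct_mulVec]
  obtain ⟨x, hx⟩ := hnorm (α / (v ⬝ᵥ C *ᵥ star v)) (by rw [star_div₀, hs, hstar, neg_div_neg_eq])
  refine ⟨x, ?_⟩
  rw [star_smul, Matrix.mulVec_smul, smul_dotProduct, dotProduct_smul, smul_smul, hx,
    smul_eq_mul, div_mul_cancel₀ _ hv]

variable [DecidableEq ι]

/-- If a skew-Hermitian matrix does not vanish on `T × T`, some vector supported on `T` is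
not isotropic for it. -/
theorem exists_anisotropic_of_skewHermitian (h2 : (2 : F) ≠ 0) {α : F} (hα : α ≠ 0)
    (hstar : star α = -α) {C : Matrix ι ι F} (hC : Cᴴ = -C) {T : Set ι}
    (hT : ∃ i ∈ T, ∃ j ∈ T, C i j ≠ 0) :
    ∃ v : ι → F, (∀ i ∉ T, v i = 0) ∧ v ⬝ᵥ C *ᵥ star v ≠ 0 := by
  have hCs (i j : ι) : star (C j i) = -C i j := by
    simpa using congrFun (congrFun hC i) j
  by_cases hdiag : ∃ i ∈ T, C i i ≠ 0
  · obtain ⟨i, hi, hii⟩ := hdiag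
    refine ⟨Pi.single i 1, fun j hj => Pi.single_eq_of_ne (by rintro rfl; exact hj hi) _, ?_⟩
    simpa [← Pi.single_star] using hii
  · push Not at hdiag
    obtain ⟨i, hi, j, hj, hij⟩ := hT
    refine ⟨Pi.single i 1 + Pi.single j (C i j * α), fun l hl => ?_, ?_⟩
    · have h1 : l ≠ i := fun h => hl (h ▸ hi)
      have h2 : l ≠ j := fun h => hl (h ▸ hj)
      simp [h1, h2]
    · have hji : C j i = -star (C i j) := by rw [hCs, neg_neg]
      have key : (Pi.single i 1 + Pi.single j (C i j * α)) ⬝ᵥ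
          C *ᵥ star (Pi.single i 1 + Pi.single j (C i j * α)) =
          -2 * α * (C i j * star (C i j)) := by
        simp [Matrix.mulVec_add, hdiag i hi, hdiag j hj, hji, hstar]
        ring
      rw [key]
      simp [h2, hα, hij]

/-- Splitting off a vector `v` of value `α` from the complement of `S`, where the form is already
diagonal along `S`. -/
theorem exists_congruent_diagonal_insert {α : F} (hα : α ≠ 0) {C : Matrix ι ι F} (hC : Cᴴ = -C)
    {S : Finset ι} (hS : ∀ i ∈ S, (C i i = 0 ∨ C i i = α) ∧ ∀ j, j ≠ i → C i j = 0)
    {v : ι → F} (hvS : ∀ i ∈ S, v i = 0) (hv : v ⬝ᵥ C *ᵥ star v = α) {a : ι} (hva : v a ≠ 0) :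
    ∃ A : Matrix ι ι F, IsUnit A ∧ ∀ i ∈ insert a S,
      ((A * C * Aᴴ) i i = 0 ∨ (A * C * Aᴴ) i i = α) ∧
        ∀ j, j ≠ i → (A * C * Aᴴ) i j = 0 := by
  have haS : a ∉ S := fun h => hva (hvS a h)
  set w : ι → F := C *ᵥ star v with hw
  have hwS : ∀ i ∈ S, w i = 0 := by
    intro i hi
    rw [hw, Matrix.mulVec, dotProduct]
    refine Finset.sum_eq_zero fun j _ => ?_
    by_cases hj : j = i
    · subst hj; simp [hvS _ hi]
    · simp [(hS i hi).2 j hj]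
  set P : Matrix ι ι F := Matrix.updateRow 1 a v with hP
  set E : Matrix ι ι F := Matrix.updateCol 1 a (fun j => if j = a then 1 else -(w j / α)) with hE
  have hrow_a : (E * P) a = v := by
    ext l
    rw [Matrix.mul_apply, Finset.sum_eq_single a]
    · simp [hE, hP]
    · intro b _ hb; simp [hE, hb, hb.symm]
    · simp
  have hrow (j : ι) (hj : j ≠ a) : (E * P) j = Pi.single j 1 - (w j / α) • v := by
    ext l
    rw [Matrix.mul_apply, Finset.sum_eq_add j a hj]
    · simp [hE, hP, hj, Matrix.one_apply, Pi.single_apply, eq_comm (a := l), sub_eq_add_neg]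
    · intro b _ hb; simp [hE, hb.1.symm, hb.2]
    · simp
    · simp
  have hentry (A : Matrix ι ι F) (i j : ι) : (A * C * Aᴴ) i j = A i ⬝ᵥ C *ᵥ star (A j) := by
    rw [Matrix.mul_assoc]
    rfl
  have hunit : IsUnit (E * P) := by
    have hdetE : E.det = 1 := by
      rw [hE, ← Matrix.cramer_apply, Matrix.cramer_one]
      simp
    have hdetP : P.det = v a := by
      rw [hP, ← Matrix.cramer_transpose_apply, Matrix.transpose_one, Matrix.cramer_one]
      simp
    rw [Matrix.isUnit_iff_isUnit_det, Matrix.det_mul, hdetE, hdetP, one_mul]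
    exact hva.isUnit
  have hskew : (E * P * C * (E * P)ᴴ)ᴴ = -(E * P * C * (E * P)ᴴ) := by
    simp [Matrix.conjTranspose_mul, hC, Matrix.mul_assoc]
  have haa : (E * P * C * (E * P)ᴴ) a a = α := by
    rw [hentry, hrow_a, hv]
  have hja (j : ι) (hj : j ≠ a) : (E * P * C * (E * P)ᴴ) j a = 0 := by
    rw [hentry, hrow_a, hrow j hj, ← hw, sub_dotProduct, smul_dotProduct, hv,
      single_one_dotProduct, smul_eq_mul, div_mul_cancel₀ _ hα, sub_self]
  have haj (j : ι) (hj : j ≠ a) : (E * P * C * (E * P)ᴴ) a j = 0 := by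
    have h := congrFun (congrFun hskew a) j
    rw [Matrix.conjTranspose_apply, hja j hj, star_zero, Matrix.neg_apply] at h
    exact neg_eq_zero.mp h.symm
  have hij (i : ι) (hi : i ∈ S) (j : ι) (hj : j ≠ a) :
      (E * P * C * (E * P)ᴴ) i j = C i j := by
    have hia : i ≠ a := fun h => haS (h ▸ hi)
    rw [hentry, hrow i hia, hrow j hj, hwS i hi, zero_div, zero_smul, sub_zero,
      single_one_dotProduct, star_sub, star_smul, Matrix.mulVec_sub, Matrix.mulVec_smul, ← hw,
      Pi.sub_apply, Pi.smul_apply, hwS i hi, smul_zero, sub_zero]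
    simp
  refine ⟨E * P, hunit, fun i hi => ?_⟩
  rcases Finset.mem_insert.mp hi with rfl | hi
  · exact ⟨Or.inr haa, haj⟩
  · have hia : i ≠ a := fun h => haS (h ▸ hi)
    refine ⟨by rw [hij i hi i hia]; exact (hS i hi).1, fun j hj => ?_⟩
    by_cases hj_eq : j = a
    · rw [hj_eq, hja i hia]
    · rw [hij i hi j hj_eq, (hS i hi).2 j hj]

/-- Given a nonzero skew element `α`, every skew-Hermitian matrix is congruent to a diagonal
matrix with entries `0` and `α`, provided that the norm `x ↦ x * star x` is onto the fixed field of `star`. -/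
theorem exists_congruent_diagonal (h2 : (2 : F) ≠ 0) {α : F} (hα : α ≠ 0) (hstar : star α = -α)
    (hnorm : ∀ c : F, star c = c → ∃ x, x * star x = c)
    {C : Matrix ι ι F} (hC : Cᴴ = -C) :
    ∃ (A : Matrix ι ι F) (d : ι → F), IsUnit A ∧ (∀ i, d i = 0 ∨ d i = α) ∧
      A * C * Aᴴ = Matrix.diagonal d := by
  let Good (S : Finset ι) : Prop := ∃ A : Matrix ι ι F, IsUnit A ∧ ∀ i ∈ S,
      ((A * C * Aᴴ) i i = 0 ∨ (A * C * Aᴴ) i i = α) ∧ ∀ j, j ≠ i → (A * C * Aᴴ) i j = 0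
  obtain ⟨S, hS⟩ := (Set.toFinite {S | Good S}).exists_maximal ⟨∅, 1, isUnit_one, by simp⟩
  obtain ⟨⟨A, hA, hAS⟩, hmax⟩ := hS
  have hskew : (A * C * Aᴴ)ᴴ = -(A * C * Aᴴ) := by
    simp [Matrix.conjTranspose_mul, hC, Matrix.mul_assoc]
  have hCs (i j : ι) : (A * C * Aᴴ) i j = -star ((A * C * Aᴴ) j i) := by
    have := congrFun (congrFun hskew i) j
    rw [Matrix.conjTranspose_apply, Matrix.neg_apply] at this
    rw [this, neg_neg]
  have hzero : ∀ i ∉ S, ∀ j ∉ S, (A * C * Aᴴ) i j = 0 := by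
    by_contra! hne
    obtain ⟨u, huS, hu⟩ := exists_anisotropic_of_skewHermitian h2 hα hstar hskew
      (T := {i | i ∉ S}) hne
    obtain ⟨x, hx⟩ := exists_eq_of_anisotropic hstar hnorm hskew hu
    have hx0 : x • u ≠ 0 := by
      intro h
      rw [h, zero_dotProduct] at hx
      exact hα hx.symm
    obtain ⟨a, ha⟩ := Function.ne_iff.mp hx0
    have hxS : ∀ i ∈ S, (x • u) i = 0 := fun i hi => by simp [huS i (by simpa using hi)]
    obtain ⟨B, hB, hBS⟩ := exists_congruent_diagonal_insert hα hskew hAS hxS hx ha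
    have hgood : Good (insert a S) := by
      refine ⟨B * A, hB.mul hA, ?_⟩
      simpa only [Matrix.conjTranspose_mul, Matrix.mul_assoc] using hBS
    exact ha (hxS a (hmax hgood (Finset.subset_insert a S) (Finset.mem_insert_self a S)))
  refine ⟨A, fun i => (A * C * Aᴴ) i i, hA, fun i => ?_, ?_⟩
  · by_cases hi : i ∈ S
    · exact (hAS i hi).1
    · exact Or.inl (hzero i hi i hi)
  · ext i j
    by_cases hij : i = j
    · subst hij; simp
    · rw [Matrix.diagonal_apply_ne _ hij]
      by_cases hi : i ∈ S
      · exact (hAS i hi).2 j (Ne.symm hij)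
      · by_cases hj : j ∈ S
        · rw [hCs, (hAS j hj).2 i hij, star_zero, neg_zero]
        · exact hzero i hi j hj

end SkewHermitian

/-- A diagonal matrix with entries `0` and `α` can be sorted by a permutation. -/
theorem exists_perm_diagonal {F : Type*} [Field F] [DecidableEq F] {n : ℕ} {α : F} {d : Fin n → F}
    (hd : ∀ i, d i = 0 ∨ d i = α) :
    ∃ σ : Equiv.Perm (Fin n), ∀ i,
      d (σ i) = if (i : ℕ) < (Matrix.diagonal d).rank then α else 0 := by
  have hle : (Matrix.diagonal d).rank ≤ n := by
    simpa using Matrix.rank_le_card_width (Matrix.diagonal d)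
  have hcard : Fintype.card {i : Fin n // (i : ℕ) < (Matrix.diagonal d).rank} =
      Fintype.card {i // d i ≠ 0} := by
    rw [← Matrix.rank_diagonal, Fintype.card_subtype, Fin.card_filter_val_lt, min_eq_right hle]
  let e := Fintype.equivOfCardEq hcard
  refine ⟨e.extendSubtype, fun i => ?_⟩
  split_ifs with hi
  · exact (hd _).resolve_left (e.extendSubtype_mem i hi)
  · exact not_not.mp (e.extendSubtype_not_mem i hi)

section FiniteField

variable {F : Type*} [Field F] [Fintype F] {q : ℕ}

/-- A field with `q ^ 2` elements contains a nonzero element of trace zero over `𝔽_q`. -/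
theorem exists_ne_zero_add_pow_eq_zero (hF : Fintype.card F = q ^ 2) (hq : 1 < q)
    (hadd : ∀ x y : F, (x - y) ^ q = x ^ q - y ^ q) : ∃ α : F, α ≠ 0 ∧ α + α ^ q = 0 := by
  classical
  have hex : ∃ x : F, x ^ q ≠ x := by
    by_contra! hall
    have hp0 : (Polynomial.X ^ q - Polynomial.X : Polynomial F) ≠ 0 :=
      FiniteField.X_pow_card_sub_X_ne_zero F hq
    have hle := Polynomial.card_le_degree_of_subset_roots (Z := Finset.univ)
      (p := (Polynomial.X ^ q - Polynomial.X : Polynomial F)) (by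
        intro x _
        rw [Polynomial.mem_roots hp0]
        simp [hall])
    rw [FiniteField.X_pow_card_sub_X_natDegree_eq F hq, Finset.card_univ, hF] at hle
    nlinarith
  obtain ⟨x, hx⟩ := hex
  refine ⟨x - x ^ q, sub_ne_zero.mpr (Ne.symm hx), ?_⟩
  rw [hadd, ← pow_mul, ← sq, ← hF, FiniteField.pow_card]
  ring

/-- The norm from `𝔽_{q²}` to `𝔽_q` is surjective. -/
theorem exists_mul_pow_eq (hF : Fintype.card F = q ^ 2) (hq : 1 < q) {c : F} (hc : c ^ q = c) :
    ∃ x : F, x * x ^ q = c := by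
  classical
  rcases eq_or_ne c 0 with rfl | hc0
  · exact ⟨0, zero_mul _⟩
  obtain ⟨g, hg⟩ := IsCyclic.exists_monoid_generator (α := Fˣ)
  obtain ⟨m, hm⟩ := Submonoid.mem_powers_iff _ _ |>.mp (hg (Units.mk0 c hc0))
  have hord : orderOf g = (q - 1) * (q + 1) := by
    rw [orderOf_eq_card_of_forall_mem_powers hg, Nat.card_eq_fintype_card, Fintype.card_units, hF,
      mul_comm, ← Nat.sq_sub_sq, one_pow]
  have hpow : g ^ ((q - 1) * m) = 1 := by
    rw [mul_comm, pow_mul, hm]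
    ext
    have h : c ^ (q - 1) * c = 1 * c := by
      rw [← pow_succ, Nat.sub_add_cancel hq.le, hc, one_mul]
    simpa using mul_right_cancel₀ hc0 h
  obtain ⟨l, rfl⟩ : q + 1 ∣ m := by
    have h := orderOf_dvd_of_pow_eq_one hpow
    rw [hord] at h
    exact Nat.dvd_of_mul_dvd_mul_left (by lia) h
  refine ⟨(g ^ l : Fˣ), ?_⟩
  rw [← pow_succ', ← Units.val_pow_eq_pow_val, ← pow_mul, mul_comm, hm, Units.val_mk0]

end FiniteField

/-- every skew-Hermitian `n×n` matrix `C` over `𝔽_{q²}` of rank `r` is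
congruent (via `C ↦ A·C·(Ā)ᵀ` with `A` invertible) to `α·[[I_r, 0],[0, 0]]` for some
`α ≠ 0` with `α + α^q = 0`. -/
theorem skewHermitian_congruent_diagonal
    (p k q : ℕ) (hp : p.Prime) (hpodd : Odd p) (hk : 1 ≤ k) (hq : q = p ^ k)
    (F : Type) [Field F] [Fintype F] (hF : Fintype.card F = q ^ 2)
    (n r : ℕ)
    (C : Matrix (Fin n) (Fin n) F)
    (hC : (C.map (fun x => x ^ q))ᵀ = -C)
    (hr : C.rank = r) :
    ∃ (A : Matrix (Fin n) (Fin n) F) (α : F), IsUnit A ∧ α ≠ 0 ∧ α + α ^ q = 0 ∧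
      A * C * (A.map (fun x => x ^ q))ᵀ =
        Matrix.of (fun i j : Fin n => if i = j ∧ (i : ℕ) < r then α else 0) := by
  classical
  have := Fact.mk hp
  have hq1 : 1 < q := hq ▸ Nat.one_lt_pow (by lia) hp.one_lt
  have hchar : CharP F p := by
    obtain ⟨l, hl⟩ := CharP.exists F
    obtain ⟨m, hlp, hm⟩ := FiniteField.card F l
    have hdvd : l ∣ p ^ (k * 2) := by
      rw [pow_mul, ← hq, ← hF, hm]
      exact dvd_pow_self l m.ne_zero
    rwa [← (Nat.prime_dvd_prime_iff_eq hlp hp).mp (hlp.dvd_of_dvd_pow hdvd)]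
  have h2 : (2 : F) ≠ 0 := by
    refine Ring.two_ne_zero ?_
    rw [ringChar.eq F p]
    rintro rfl
    exact absurd hpodd (by decide)
  let _ : StarRing F :=
    { star := fun x => x ^ q
      star_involutive := fun x => by
        change (x ^ q) ^ q = x
        rw [← pow_mul, ← sq, ← hF, FiniteField.pow_card]
      star_mul := fun x y => by
        change (x * y) ^ q = y ^ q * x ^ q
        rw [mul_pow, mul_comm]
      star_add := fun x y => by
        change (x + y) ^ q = x ^ q + y ^ q
        rw [hq, add_pow_char_pow] }
  obtain ⟨α, hα, hαq⟩ := exists_ne_zero_add_pow_eq_zero hF hq1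
    (fun x y => by rw [hq, sub_pow_char_pow])
  have hstar : star α = -α := eq_neg_of_add_eq_zero_right hαq
  obtain ⟨A, d, hA, hd, hAC⟩ := exists_congruent_diagonal h2 hα hstar
    (fun c hc => exists_mul_pow_eq hF hq1 hc) (C := C) hC
  obtain ⟨σ, hσ⟩ := exists_perm_diagonal hd
  have hdet := (Matrix.isUnit_iff_isUnit_det A).mp hA
  have hrank : (Matrix.diagonal d).rank = r := by
    have hdetH : IsUnit (Aᴴ).det := by
      rw [Matrix.det_conjTranspose]; exact hdet.star
    rw [← hAC, Matrix.rank_mul_eq_left_of_isUnit_det _ _ hdetH,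
      Matrix.rank_mul_eq_right_of_isUnit_det _ _ hdet, hr]
  refine ⟨A.submatrix σ id, α, ?_, hα, hαq, ?_⟩
  · exact (Matrix.isUnit_submatrix_equiv σ (Equiv.refl _)).mpr hA
  · change A.submatrix σ id * C * (A.submatrix σ id)ᴴ = _
    have hsub : A.submatrix σ id * C * (A.submatrix σ id)ᴴ = (A * C * Aᴴ).submatrix σ σ := by
      ext i j
      simp [Matrix.mul_apply]
    rw [hsub, hAC]
    ext i j
    rw [Matrix.submatrix_apply, Matrix.diagonal_apply, Matrix.of_apply, hσ, hrank]
    by_cases hij : i = j <;> simp [hij]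
end

section
/- Let q be a power of an odd prime, let n, r be integers with 0 ≤ r ≤ n, and let α ∈ 𝔽_{q²} satisfy α ≠ 0 and α + α^q = 0. Let X = α·[[I_r, 0],[0, 0]] ∈ Mat_n(𝔽_{q²}). For P ∈ GL_n(𝔽_{q²}), write P = [[A, B],[C, D]] in blocks with A of size r×r and D of size (n−r)×(n−r). Then P·X·(P̄)^t = X if and only if C = 0 and A·(Ā)^t = I_r (in particular, then A is unitary and D ∈ GL_{n−r}(𝔽_{q²})). -/
open Matrix

/-- For any entrywise map `σ` fixing zero, `P = [[A, B], [C, D]]` satisfies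
`P * [[α, 0], [0, 0]] * (σ P)ᵀ = [[α, 0], [0, 0]]` iff `C = 0` and `A * (σ A)ᵀ = 1`. -/
theorem fromBlocks_conj_eq_iff {F m n : Type*} [Field F] [Fintype m] [DecidableEq m] [Fintype n]
    (σ : F → F) (hσ : σ 0 = 0) {α : F} (hα : α ≠ 0)
    (A : Matrix m m F) (B : Matrix m n F) (C : Matrix n m F) (D : Matrix n n F) :
    fromBlocks A B C D * fromBlocks (α • (1 : Matrix m m F)) 0 0 0 *
        ((fromBlocks A B C D).map σ)ᵀ = fromBlocks (α • (1 : Matrix m m F)) 0 0 0 ↔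
      C = 0 ∧ A * (A.map σ)ᵀ = 1 := by
  simp only [fromBlocks_map, fromBlocks_transpose, fromBlocks_multiply, Matrix.mul_zero,
    Matrix.zero_mul, add_zero, Matrix.mul_smul, Matrix.smul_mul, Matrix.mul_one,
    fromBlocks_inj, smul_eq_zero_iff_right hα, smul_right_inj hα]
  constructor
  · rintro ⟨hA, -, hC, -⟩
    refine ⟨?_, hA⟩
    rw [← Matrix.mul_one C, ← mul_eq_one_comm.1 hA, ← Matrix.mul_assoc, hC, Matrix.zero_mul]
  · rintro ⟨rfl, hA⟩
    simp [hA, Matrix.map_zero σ hσ]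

/-- the stabilizer of `X = α·[[I_r, 0],[0, 0]]` under the conjugate-congruence
action of `GL_n(𝔽_{q²})`: for invertible `P = [[A, B],[C, D]]`, `P·X·(P̄)ᵀ = X` iff `C = 0`
and `A·(Ā)ᵀ = I_r`; in particular `A` is then unitary and `D` is invertible. -/
theorem congruence_stabilizer_skewHermitian
    (p k q : ℕ) (hp : p.Prime) (hpodd : Odd p) (hk : 1 ≤ k) (hq : q = p ^ k)
    (F : Type) [Field F] [Fintype F] (hF : Fintype.card F = q ^ 2)
    (n r : ℕ) (hr : r ≤ n)
    (α : F) (hα : α ≠ 0) (hα2 : α + α ^ q = 0)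
    (X : Matrix (Fin r ⊕ Fin (n - r)) (Fin r ⊕ Fin (n - r)) F)
    (hX : X = Matrix.fromBlocks (α • (1 : Matrix (Fin r) (Fin r) F)) 0 0 0)
    (A : Matrix (Fin r) (Fin r) F)
    (B : Matrix (Fin r) (Fin (n - r)) F)
    (C : Matrix (Fin (n - r)) (Fin r) F)
    (D : Matrix (Fin (n - r)) (Fin (n - r)) F)
    (P : Matrix (Fin r ⊕ Fin (n - r)) (Fin r ⊕ Fin (n - r)) F)
    (hP : P = Matrix.fromBlocks A B C D)
    (hPunit : IsUnit P) :
    (P * X * (P.map (fun x => x ^ q))ᵀ = X ↔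
      C = 0 ∧ A * (A.map (fun x => x ^ q))ᵀ = 1) ∧
    (P * X * (P.map (fun x => x ^ q))ᵀ = X → IsUnit A ∧ IsUnit D) := by
  have hq0 : q ≠ 0 := hq ▸ pow_ne_zero k hp.ne_zero
  subst hX hP
  have key := fromBlocks_conj_eq_iff (fun x : F => x ^ q) (zero_pow hq0) hα A B C D
  refine ⟨key, fun h => ?_⟩
  obtain ⟨rfl, hA⟩ := key.1 h
  exact Matrix.isUnit_fromBlocks_zero₂₁.1 hPunit
end

section
/- Let q be a power of an odd prime and let n, d be integers with 1 ≤ d ≤ n−1. Then A^U := { [[I_d, 0, B1, B2],[0, I_{n−d}, 0, B3],[0, 0, I_{n−d}, 0],[0, 0, 0, I_d]] : B1 ∈ Mat_{d×(n−d)}(𝔽_{q²}), B2 ∈ Mat_{d×d}(𝔽_{q²}), B3 ∈ Mat_{(n−d)×d}(𝔽_{q²}), B1 = −J_d·(B̄3)^t·J_{n−d}, B2 = −J_d·(B̄2)^t·J_d } and H^U := { [[I_d, A1, 0, 0],[0, I_{n−d}, 0, 0],[0, 0, I_{n−d}, A2],[0, 0, 0, I_d]] : A1 ∈ Mat_{d×(n−d)}(𝔽_{q²}),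 A2 ∈ Mat_{(n−d)×d}(𝔽_{q²}), A1 = −J_d·(Ā2)^t·J_{n−d} } are abelian subgroups of U_{2n}(q²) contained in R_u^{U,d}; A^U is normal in R_u^{U,d}, H^U is abelian, A^U ∩ H^U = {I_{2n}}, and R_u^{U,d} = A^U·H^U, so that R_u^{U,d} is the internal semidirect product A^U ⋊ H^U. -/
open Matrix

namespace UnitaryUnipotentRadical

/-- Index type for `2n×2n` matrices, split as `d + (n−d) + (n−d) + d`. -/
abbrev κ (n d : ℕ) := (Fin d ⊕ Fin (n - d)) ⊕ (Fin (n - d) ⊕ Fin d)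

/-- The `m × m` matrix with `1`'s on the antidiagonal and `0`'s elsewhere. -/
def antidiagMat (F : Type) [Field F] (m : ℕ) : Matrix (Fin m) (Fin m) F :=
  Matrix.of fun i j => if (i : ℕ) + (j : ℕ) = m - 1 then 1 else 0

/-- The antidiagonal matrix `J_{2n}`, written in block form with respect to the
partition `d + (n−d) + (n−d) + d`. -/
def J2n (F : Type) [Field F] (n d : ℕ) : Matrix (κ n d) (κ n d) F :=
  Matrix.fromBlocks 0
    (Matrix.fromBlocks 0 (antidiagMat F d) (antidiagMat F (n - d)) 0)
    (Matrix.fromBlocks 0 (antidiagMat F (n - d)) (antidiagMat F d) 0) 0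

/-- The level of an index with respect to the three-block partition `d + (2n−2d) + d`. -/
def lvl (n d : ℕ) : κ n d → ℕ
  | Sum.inl (Sum.inl _) => 0
  | Sum.inl (Sum.inr _) => 1
  | Sum.inr (Sum.inl _) => 1
  | Sum.inr (Sum.inr _) => 2

/-- `R_u^{U,d}`: elements of `U_{2n}(q²)` of the form `[[I_d, X, Y],[0, I_{2n−2d}, Z],
[0, 0, I_d]]` with respect to the partition `d + (2n−2d) + d`. -/
def RuU (q : ℕ) (F : Type) [Field F] (n d : ℕ) : Set (Matrix (κ n d) (κ n d) F) :=
  {g | (g.map (fun x => x ^ q))ᵀ * J2n F n d * g = J2n F n d ∧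
    (∀ i j, lvl n d j < lvl n d i → g i j = 0) ∧
    (∀ i j, lvl n d i = lvl n d j → g i j = if i = j then 1 else 0)}

/-- `A^U`. -/
def AU (q : ℕ) (F : Type) [Field F] (n d : ℕ) : Set (Matrix (κ n d) (κ n d) F) :=
  {g | ∃ (B1 : Matrix (Fin d) (Fin (n - d)) F) (B2 : Matrix (Fin d) (Fin d) F)
      (B3 : Matrix (Fin (n - d)) (Fin d) F),
    B1 = -(antidiagMat F d) * (B3.map (fun x => x ^ q))ᵀ * antidiagMat F (n - d) ∧
    B2 = -(antidiagMat F d) * (B2.map (fun x => x ^ q))ᵀ * antidiagMat F d ∧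
    g = Matrix.fromBlocks 1 (Matrix.fromBlocks B1 B2 0 B3) 0 1}

/-- `H^U`. -/
def HU (q : ℕ) (F : Type) [Field F] (n d : ℕ) : Set (Matrix (κ n d) (κ n d) F) :=
  {g | ∃ (A1 : Matrix (Fin d) (Fin (n - d)) F) (A2 : Matrix (Fin (n - d)) (Fin d) F),
    A1 = -(antidiagMat F d) * (A2.map (fun x => x ^ q))ᵀ * antidiagMat F (n - d) ∧
    g = Matrix.fromBlocks (Matrix.fromBlocks 1 A1 0 1) 0 0 (Matrix.fromBlocks 1 A2 0 1)}

section Antidiagonal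

variable (F : Type) [Field F]

theorem antidiagMat_apply (m : ℕ) (i j : Fin m) :
    antidiagMat F m i j = if j = Fin.rev i then 1 else 0 := by
  have h : (i : ℕ) + (j : ℕ) = m - 1 ↔ j = Fin.rev i := by
    rw [Fin.ext_iff, Fin.val_rev]
    omega
  simp only [antidiagMat, Matrix.of_apply, h]

theorem antidiagMat_mul_self (m : ℕ) : antidiagMat F m * antidiagMat F m = 1 := by
  ext i j
  simp only [Matrix.mul_apply, antidiagMat_apply, ite_mul, one_mul, zero_mul,
    Finset.sum_ite_eq', Finset.mem_univ, if_true, Fin.rev_rev,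
    Matrix.one_apply, eq_comm (a := i)]

theorem antidiagMat_transpose (m : ℕ) : (antidiagMat F m)ᵀ = antidiagMat F m := by
  ext i j
  simp [antidiagMat, add_comm]

theorem antidiagMat_map (φ : F →+* F) (m : ℕ) :
    (antidiagMat F m).map φ = antidiagMat F m := by
  ext i j
  simp [antidiagMat_apply, apply_ite φ]

theorem J2n_mul_self (n d : ℕ) : J2n F n d * J2n F n d = 1 := by
  simp [J2n, Matrix.fromBlocks_multiply, antidiagMat_mul_self]

end Antidiagonal

section Adjoint

variable {F : Type} [Field F] (φ : F →+* F)

/-- The adjoint `J · (φ M)ᵀ · J` of a rectangular matrix with respect to the antidiagonal forms. -/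
def adj {a b : ℕ} (M : Matrix (Fin a) (Fin b) F) : Matrix (Fin b) (Fin a) F :=
  antidiagMat F b * (M.map φ)ᵀ * antidiagMat F a

theorem adj_add {a b : ℕ} (M N : Matrix (Fin a) (Fin b) F) :
    adj φ (M + N) = adj φ M + adj φ N := by
  simp [adj, Matrix.map_add, Matrix.mul_add, Matrix.add_mul]

theorem adj_zero {a b : ℕ} : adj φ (0 : Matrix (Fin a) (Fin b) F) = 0 := by
  simp [adj]

theorem adj_neg {a b : ℕ} (M : Matrix (Fin a) (Fin b) F) : adj φ (-M) = -adj φ M := by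
  rw [eq_neg_iff_add_eq_zero, ← adj_add, neg_add_cancel, adj_zero]

theorem adj_sub {a b : ℕ} (M N : Matrix (Fin a) (Fin b) F) :
    adj φ (M - N) = adj φ M - adj φ N := by
  rw [sub_eq_add_neg, adj_add, adj_neg, ← sub_eq_add_neg]

theorem adj_mul {a b c : ℕ} (M : Matrix (Fin a) (Fin b) F) (N : Matrix (Fin b) (Fin c) F) :
    adj φ (M * N) = adj φ N * adj φ M := by
  have h : ∀ X : Matrix (Fin b) (Fin a) F,
      antidiagMat F b * (antidiagMat F b * X) = X := fun X => by
    rw [← Matrix.mul_assoc, antidiagMat_mul_self, Matrix.one_mul]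
  simp only [adj, Matrix.map_mul, Matrix.transpose_mul, Matrix.mul_assoc, h]

theorem adj_adj (hφ : ∀ x, φ (φ x) = x) {a b : ℕ} (M : Matrix (Fin a) (Fin b) F) :
    adj φ (adj φ M) = M := by
  have hM : (M.map φ).map φ = M := by
    ext i j
    simp [hφ]
  simp only [adj, Matrix.map_mul, Matrix.transpose_mul, antidiagMat_map, antidiagMat_transpose,
    ← Matrix.transpose_map, Matrix.transpose_transpose, hM]
  rw [← Matrix.mul_assoc, ← Matrix.mul_assoc, antidiagMat_mul_self, Matrix.one_mul,
    Matrix.mul_assoc, antidiagMat_mul_self, Matrix.mul_one]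

theorem neg_antidiagMat_mul {a b : ℕ} (M : Matrix (Fin a) (Fin b) F) :
    -(antidiagMat F b) * (M.map φ)ᵀ * antidiagMat F a = -adj φ M := by
  simp [adj]

end Adjoint

section Unipotent

variable {F : Type} [Field F] {n d : ℕ}

/-- The block unipotent matrix `[[1, X₁, X₂, Y], [0, 1, 0, Z₁], [0, 0, 1, Z₂], [0, 0, 0, 1]]`. -/
def unip (X₁ X₂ : Matrix (Fin d) (Fin (n - d)) F) (Y : Matrix (Fin d) (Fin d) F)
    (Z₁ Z₂ : Matrix (Fin (n - d)) (Fin d) F) : Matrix (κ n d) (κ n d) F :=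
  Matrix.fromBlocks (Matrix.fromBlocks 1 X₁ 0 1) (Matrix.fromBlocks X₂ Y 0 Z₁) 0
    (Matrix.fromBlocks 1 Z₂ 0 1)

variable {X₁ X₂ X₁' X₂' : Matrix (Fin d) (Fin (n - d)) F} {Y Y' : Matrix (Fin d) (Fin d) F}
  {Z₁ Z₂ Z₁' Z₂' : Matrix (Fin (n - d)) (Fin d) F}

theorem unip_zero : (unip 0 0 0 0 0 : Matrix (κ n d) (κ n d) F) = 1 := by
  simp [unip]

theorem unip_inj : unip X₁ X₂ Y Z₁ Z₂ = unip X₁' X₂' Y' Z₁' Z₂' ↔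
    X₁ = X₁' ∧ X₂ = X₂' ∧ Y = Y' ∧ Z₁ = Z₁' ∧ Z₂ = Z₂' := by
  simp only [unip, Matrix.fromBlocks_inj]
  tauto

theorem unip_mul : unip X₁ X₂ Y Z₁ Z₂ * unip X₁' X₂' Y' Z₁' Z₂' =
    unip (X₁ + X₁') (X₂ + X₂') (Y + Y' + X₁ * Z₁' + X₂ * Z₂') (Z₁ + Z₁') (Z₂ + Z₂') := by
  simp only [unip, Matrix.fromBlocks_multiply, Matrix.fromBlocks_add, Matrix.fromBlocks_inj,
    Matrix.mul_zero, Matrix.zero_mul, Matrix.mul_one, Matrix.one_mul, add_zero, zero_add,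
    true_and, and_true, ← Matrix.fromBlocks_zero]
  refine ⟨add_comm _ _, ⟨add_comm _ _, ?_, add_comm _ _⟩, add_comm _ _⟩
  abel

theorem unip_inv : (unip X₁ X₂ Y Z₁ Z₂)⁻¹ =
    unip (-X₁) (-X₂) (X₁ * Z₁ + X₂ * Z₂ - Y) (-Z₁) (-Z₂) := by
  apply Matrix.inv_eq_right_inv
  rw [unip_mul, ← unip_zero, unip_inj]
  refine ⟨add_neg_cancel _, add_neg_cancel _, ?_, add_neg_cancel _, add_neg_cancel _⟩
  rw [Matrix.mul_neg, Matrix.mul_neg]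
  abel

theorem J2n_mul_unip_mul_J2n (φ : F →+* F) :
    J2n F n d * ((unip X₁ X₂ Y Z₁ Z₂).map φ)ᵀ * J2n F n d =
      unip (adj φ Z₂) (adj φ Z₁) (adj φ Y) (adj φ X₂) (adj φ X₁) := by
  simp [J2n, unip, adj, Matrix.fromBlocks_map, Matrix.fromBlocks_transpose,
    Matrix.fromBlocks_multiply, antidiagMat_mul_self, Matrix.map_one]

theorem unip_isometry_iff (φ : F →+* F) (hφ : ∀ x, φ (φ x) = x) :
    ((unip X₁ X₂ Y Z₁ Z₂).map φ)ᵀ * J2n F n d * unip X₁ X₂ Y Z₁ Z₂ = J2n F n d ↔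
      X₁ = -adj φ Z₂ ∧ X₂ = -adj φ Z₁ ∧
        Y + adj φ Y + adj φ Z₂ * Z₁ + adj φ Z₁ * Z₂ = 0 := by
  have hcancel : ((unip X₁ X₂ Y Z₁ Z₂).map φ)ᵀ * J2n F n d * unip X₁ X₂ Y Z₁ Z₂ = J2n F n d ↔
      J2n F n d * ((unip X₁ X₂ Y Z₁ Z₂).map φ)ᵀ * J2n F n d * unip X₁ X₂ Y Z₁ Z₂ = 1 := by
    constructor
    · intro h
      rw [← J2n_mul_self F n d, ← h]
      simp only [Matrix.mul_assoc, h]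
    · intro h
      have := congrArg (J2n F n d * ·) h
      simpa only [← Matrix.mul_assoc, J2n_mul_self, Matrix.one_mul, Matrix.mul_one] using this
  rw [hcancel, J2n_mul_unip_mul_J2n, unip_mul, ← unip_zero, unip_inj]
  constructor
  · rintro ⟨h₁, h₂, h₃, -, -⟩
    refine ⟨eq_neg_of_add_eq_zero_right h₁, eq_neg_of_add_eq_zero_right h₂, ?_⟩
    rw [← h₃]
    abel
  · rintro ⟨rfl, rfl, h₃⟩
    refine ⟨add_neg_cancel _, add_neg_cancel _, ?_, ?_, ?_⟩
    · rw [← h₃]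
      abel
    · rw [adj_neg, adj_adj φ hφ, neg_add_cancel]
    · rw [adj_neg, adj_adj φ hφ, neg_add_cancel]

theorem exists_unip_iff (g : Matrix (κ n d) (κ n d) F) :
    ((∀ i j, lvl n d j < lvl n d i → g i j = 0) ∧
      (∀ i j, lvl n d i = lvl n d j → g i j = if i = j then 1 else 0)) ↔
    ∃ X₁ X₂ Y Z₁ Z₂, g = unip X₁ X₂ Y Z₁ Z₂ := by
  constructor
  · rintro ⟨h₀, h₁⟩
    refine ⟨g.toBlocks₁₁.toBlocks₁₂, g.toBlocks₁₂.toBlocks₁₁, g.toBlocks₁₂.toBlocks₁₂,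
      g.toBlocks₁₂.toBlocks₂₂, g.toBlocks₂₂.toBlocks₁₂, ?_⟩
    ext i j
    rcases i with (i | i) | (i | i) <;> rcases j with (j | j) | (j | j) <;>
      first
      | rfl
      | (rw [h₁] <;> [simp [unip, Matrix.one_apply]; rfl])
      | (rw [h₀ _ _ (by simp [lvl])]; rfl)
  · rintro ⟨X₁, X₂, Y, Z₁, Z₂, rfl⟩
    constructor <;>
    · rintro ((i | i) | (i | i)) ((j | j) | (j | j)) <;>
        simp [lvl, unip, Matrix.one_apply]

end Unipotent

section Membership

variable {q : ℕ} {F : Type} [Field F] {n d : ℕ} {φ : F →+* F}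

theorem mem_RuU_iff (hφq : (fun x : F => x ^ q) = φ) (hφ : ∀ x, φ (φ x) = x)
    (g : Matrix (κ n d) (κ n d) F) :
    g ∈ RuU q F n d ↔ ∃ Y Z₁ Z₂, Y + adj φ Y + adj φ Z₂ * Z₁ + adj φ Z₁ * Z₂ = 0 ∧
      g = unip (-adj φ Z₂) (-adj φ Z₁) Y Z₁ Z₂ := by
  rw [RuU, Set.mem_ofPred_eq, exists_unip_iff, hφq]
  constructor
  · rintro ⟨h, X₁, X₂, Y, Z₁, Z₂, rfl⟩
    obtain ⟨rfl, rfl, hY⟩ := (unip_isometry_iff φ hφ).1 h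
    exact ⟨Y, Z₁, Z₂, hY, rfl⟩
  · rintro ⟨Y, Z₁, Z₂, hY, rfl⟩
    exact ⟨(unip_isometry_iff φ hφ).2 ⟨rfl, rfl, hY⟩, _, _, _, _, _, rfl⟩

theorem mem_AU_iff (hφq : (fun x : F => x ^ q) = φ) (g : Matrix (κ n d) (κ n d) F) :
    g ∈ AU q F n d ↔ ∃ Y Z₁, adj φ Y = -Y ∧ g = unip 0 (-adj φ Z₁) Y Z₁ 0 := by
  simp only [AU, Set.mem_ofPred_eq, hφq, neg_antidiagMat_mul, unip, Matrix.fromBlocks_one]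
  constructor
  · rintro ⟨_, Y, Z₁, rfl, hY, rfl⟩
    exact ⟨Y, Z₁, (neg_eq_iff_eq_neg.2 hY).symm, rfl⟩
  · rintro ⟨Y, Z₁, hY, rfl⟩
    exact ⟨_, Y, Z₁, rfl, (neg_eq_iff_eq_neg.2 hY).symm, rfl⟩

theorem mem_HU_iff (hφq : (fun x : F => x ^ q) = φ) (g : Matrix (κ n d) (κ n d) F) :
    g ∈ HU q F n d ↔ ∃ Z₂, g = unip (-adj φ Z₂) 0 0 0 Z₂ := by
  simp only [HU, Set.mem_ofPred_eq, hφq, neg_antidiagMat_mul, unip, Matrix.fromBlocks_zero]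
  constructor
  · rintro ⟨_, Z₂, rfl, rfl⟩
    exact ⟨Z₂, rfl⟩
  · rintro ⟨Z₂, rfl⟩
    exact ⟨_, Z₂, rfl, rfl⟩

end Membership

/-- In a field of order `q²`, with `q` a prime power, `x ↦ x ^ q` is an involutive ring
endomorphism. -/
theorem exists_involutive_ringHom_eq_pow {p k q : ℕ} (hp : p.Prime) (hq : q = p ^ k)
    {F : Type} [Field F] [Fintype F] (hF : Fintype.card F = q ^ 2) :
    ∃ φ : F →+* F, (fun x : F => x ^ q) = φ ∧ ∀ x, φ (φ x) = x := by
  have : Fact p.Prime := ⟨hp⟩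
  have : CharP F p := by
    refine charP_of_card_eq_prime_pow (f := k * 2) ?_
    rw [hF, hq, pow_mul]
  refine ⟨iterateFrobenius F p k, ?_, fun x => ?_⟩
  · ext x
    rw [iterateFrobenius_def, hq]
  · rw [iterateFrobenius_def, iterateFrobenius_def, ← hq, ← pow_mul, ← sq, ← hF,
      FiniteField.pow_card]

/-- `A^U` and `H^U` are abelian subgroups of `U_{2n}(q²)` contained in
`R_u^{U,d}`; `A^U` is normal in `R_u^{U,d}`, `A^U ∩ H^U = {1}` and
`R_u^{U,d} = A^U · H^U`, so `R_u^{U,d}` is the internal semidirect product `A^U ⋊ H^U`. -/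
theorem ruU_semidirect
    (p k q : ℕ) (hp : p.Prime) (hpodd : Odd p) (hk : 1 ≤ k) (hq : q = p ^ k)
    (F : Type) [Field F] [Fintype F] (hF : Fintype.card F = q ^ 2)
    (n d : ℕ) (hd : 1 ≤ d) (hdn : d ≤ n - 1) :
    -- A^U is an abelian subgroup of U_{2n}(q²) contained in R_u^{U,d}
    AU q F n d ⊆ RuU q F n d ∧
    (1 : Matrix (κ n d) (κ n d) F) ∈ AU q F n d ∧
    (∀ x ∈ AU q F n d, ∀ y ∈ AU q F n d, x * y ∈ AU q F n d) ∧
    (∀ x ∈ AU q F n d, x⁻¹ ∈ AU q F n d) ∧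
    (∀ x ∈ AU q F n d, ∀ y ∈ AU q F n d, x * y = y * x) ∧
    -- H^U is an abelian subgroup of U_{2n}(q²) contained in R_u^{U,d}
    HU q F n d ⊆ RuU q F n d ∧
    (1 : Matrix (κ n d) (κ n d) F) ∈ HU q F n d ∧
    (∀ x ∈ HU q F n d, ∀ y ∈ HU q F n d, x * y ∈ HU q F n d) ∧
    (∀ x ∈ HU q F n d, x⁻¹ ∈ HU q F n d) ∧
    (∀ x ∈ HU q F n d, ∀ y ∈ HU q F n d, x * y = y * x) ∧
    -- A^U is normal in R_u^{U,d}
    (∀ g ∈ RuU q F n d, ∀ a ∈ AU q F n d, g * a * g⁻¹ ∈ AU q F n d) ∧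
    -- A^U ∩ H^U = {1} and R_u^{U,d} = A^U · H^U
    AU q F n d ∩ HU q F n d = {1} ∧
    RuU q F n d = {x | ∃ a ∈ AU q F n d, ∃ h ∈ HU q F n d, x = a * h} := by
  obtain ⟨φ, hφq, hφ⟩ := exists_involutive_ringHom_eq_pow hp hq hF
  simp only [Set.subset_def, Set.ext_iff, Set.mem_inter_iff, Set.mem_ofPred_eq,
    Set.mem_singleton_iff, mem_RuU_iff hφq hφ, mem_AU_iff hφq, mem_HU_iff hφq]
  refine ⟨?_, ?_, ?_, ?_, ?_, ?_, ?_, ?_, ?_, ?_, ?_, ?_, ?_⟩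
  · rintro _ ⟨Y, Z, hY, rfl⟩
    exact ⟨Y, Z, 0, by simp [hY, adj_zero], by simp [adj_zero]⟩
  · exact ⟨0, 0, by simp [adj_zero], by simp [adj_zero, unip_zero]⟩
  · rintro _ ⟨Y, Z, hY, rfl⟩ _ ⟨Y', Z', hY', rfl⟩
    refine ⟨Y + Y', Z + Z', by rw [adj_add, hY, hY', neg_add], ?_⟩
    rw [unip_mul, adj_add, neg_add]
    simp
  · rintro _ ⟨Y, Z, hY, rfl⟩
    refine ⟨-Y, -Z, by rw [adj_neg, hY], ?_⟩
    rw [unip_inv, adj_neg]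
    simp
  · rintro _ ⟨Y, Z, hY, rfl⟩ _ ⟨Y', Z', hY', rfl⟩
    rw [unip_mul, unip_mul]
    simp [add_comm]
  · rintro _ ⟨Z, rfl⟩
    exact ⟨0, 0, Z, by simp [adj_zero], by simp [adj_zero]⟩
  · exact ⟨0, by simp [adj_zero, unip_zero]⟩
  · rintro _ ⟨Z, rfl⟩ _ ⟨Z', rfl⟩
    refine ⟨Z + Z', ?_⟩
    rw [unip_mul, adj_add, neg_add]
    simp
  · rintro _ ⟨Z, rfl⟩
    refine ⟨-Z, ?_⟩
    rw [unip_inv, adj_neg]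
    simp
  · rintro _ ⟨Z, rfl⟩ _ ⟨Z', rfl⟩
    rw [unip_mul, unip_mul]
    simp [add_comm]
  · rintro _ ⟨Y, Z₁, Z₂, -, rfl⟩ _ ⟨B, Z, hB, rfl⟩
    refine ⟨B - adj φ Z₂ * Z + adj φ Z * Z₂, Z, ?_, ?_⟩
    · rw [adj_add, adj_sub, adj_mul, adj_mul, adj_adj φ hφ, adj_adj φ hφ, hB]
      abel
    · rw [unip_inv, unip_mul, unip_mul, unip_inj]
      refine ⟨by abel, by abel, ?_, by abel, by abel⟩
      simp only [Matrix.add_mul, Matrix.neg_mul, Matrix.mul_neg, Matrix.mul_zero, add_zero]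
      abel
  · intro x
    constructor
    · rintro ⟨⟨Y, Z, -, rfl⟩, Z', h⟩
      obtain ⟨-, h₂, h₃, h₄, -⟩ := unip_inj.1 h
      rw [h₂, h₃, h₄, unip_zero]
    · rintro rfl
      exact ⟨⟨0, 0, by simp [adj_zero], by simp [adj_zero, unip_zero]⟩, 0,
        by simp [adj_zero, unip_zero]⟩
  · intro x
    constructor
    · rintro ⟨Y, Z₁, Z₂, hY, rfl⟩
      refine ⟨_, ⟨Y + adj φ Z₁ * Z₂, Z₁, ?_, rfl⟩, _, ⟨Z₂, rfl⟩, ?_⟩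
      · rw [adj_add, adj_mul, adj_adj φ hφ, eq_neg_iff_add_eq_zero, ← hY]
        abel
      · rw [unip_mul]
        simp
    · rintro ⟨_, ⟨Y, Z₁, hY, rfl⟩, _, ⟨Z₂, rfl⟩, rfl⟩
      refine ⟨Y - adj φ Z₁ * Z₂, Z₁, Z₂, ?_, ?_⟩
      · rw [adj_sub, adj_mul, adj_adj φ hφ, hY]
        abel
      · rw [unip_mul]
        simp [sub_eq_add_neg]

end UnitaryUnipotentRadical
end

section
/- Let q be a power of an odd prime and let n, d, r be integers with 1 ≤ d < n and 0 ≤ r ≤ d, and set e = (n−d)r. If r = 2s is even, then the number of irreducible characters of R_u^{C,d} of degree q^e equals q^{2d(n−d)−2e} · ∏_{i=1}^{s} q^{2i}/(q^{2i}−1) · ∏_{i=0}^{2s−1} (q^{d−i}−1); if r = 2s+1 is odd, it equals q^{2d(n−d)−2e} · ∏_{i=1}^{s} q^{2i}/(q^{2i}−1) · ∏_{i=0}^{2s} (q^{d−i}−1). Moreover, the set of integers that occur as degrees of irreducible characters of R_u^{C,d} is precisely { q^{(n−d)r} : 0 ≤ r ≤ d }. -/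
open Matrix

namespace SpUnipotentRadical

/-- The index type for `n×n` matrices, split as `d + (n−d)`. -/
abbrev ι (n d : ℕ) := Fin d ⊕ Fin (n - d)

/-- The index type for `2n×2n` matrices, split as `n + n`. -/
abbrev κ (n d : ℕ) := ι n d ⊕ ι n d

/-- `U(A) = [[I_d, A],[0, I_{n−d}]]`. -/
def Umat (F : Type) [Field F] (n d : ℕ) (A : Matrix (Fin d) (Fin (n - d)) F) :
    Matrix (ι n d) (ι n d) F :=
  Matrix.fromBlocks 1 A 0 1

/-- `S_d`: symmetric `n×n` matrices whose lower-right `(n−d)×(n−d)` block is zero. -/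
def Sd (F : Type) [Field F] (n d : ℕ) : Set (Matrix (ι n d) (ι n d) F) :=
  {V | Vᵀ = V ∧ ∀ i j, V (Sum.inr i) (Sum.inr j) = 0}

/-- `R_u^{C,d} = { [[U(A), V·U(A)⁻ᵀ],[0, U(A)⁻ᵀ]] | A ∈ Mat_{d×(n−d)}, V ∈ S_d }`. -/
def RuC (F : Type) [Field F] (n d : ℕ) : Set (Matrix (κ n d) (κ n d) F) :=
  {g | ∃ (A : Matrix (Fin d) (Fin (n - d)) F) (V : Matrix (ι n d) (ι n d) F),
    V ∈ Sd F n d ∧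
    g = Matrix.fromBlocks (Umat F n d A) (V * ((Umat F n d A)ᵀ)⁻¹) 0 ((Umat F n d A)ᵀ)⁻¹}

section Border
variable {F : Type*} [Field F] {ι : Type*} [Fintype ι]

/-- The symmetric bordering of a square matrix by a vector and a scalar. -/
def border (M : Matrix ι ι F) (v : ι → F) (a : F) : Matrix (ι ⊕ Unit) (ι ⊕ Unit) F :=
  fromBlocks M (replicateCol Unit v) (replicateRow Unit v) (of fun _ _ => a)

theorem border_mulVec_eq_zero_iff (M : Matrix ι ι F) (v : ι → F) (a : F) (w : ι → F) (t : F) :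
    border M v a *ᵥ (Sum.elim w fun _ => t) = 0 ↔ M *ᵥ w + t • v = 0 ∧ v ⬝ᵥ w + a * t = 0 := by
  rw [border, fromBlocks_mulVec]
  simp only [funext_iff, Sum.forall]
  simp [mulVec, dotProduct, replicateCol, replicateRow, mul_comm]

theorem rank_add_finrank_ker (M : Matrix ι ι F) :
    M.rank + Module.finrank F (LinearMap.ker M.mulVecLin) = Fintype.card ι := by
  rw [Matrix.rank, LinearMap.finrank_range_add_finrank_ker, Module.finrank_fintype_fun_eq_card]

theorem exists_mulVec_eq_zero_dotProduct_ne_zero [DecidableEq ι] {M : Matrix ι ι F}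
    (hM : M.IsSymm) {v : ι → F}
    (hv : v ∉ LinearMap.range M.mulVecLin) : ∃ w, M *ᵥ w = 0 ∧ v ⬝ᵥ w ≠ 0 := by
  obtain ⟨f, hf, hle⟩ := Submodule.exists_le_ker_of_notMem hv
  obtain ⟨w, rfl⟩ := (dotProductEquiv F ι).surjective f
  refine ⟨w, ?_, by simpa [dotProduct_comm] using hf⟩
  apply dotProduct_eq_zero
  intro x
  have := hle ⟨x, rfl⟩
  simp at this
  rw [dotProduct_mulVec] at this
  rw [← hM, mulVec_transpose]
  exact this


theorem rank_border_of_finrank_range {V : Type*} [AddCommGroup V] [Module F V]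
    {M : Matrix ι ι F} {v : ι → F} {a : F} (L : V →ₗ[F] (ι ⊕ Unit → F))
    (hL : Function.Injective L) (h : ∀ w t, border M v a *ᵥ (Sum.elim w fun _ => t) = 0 ↔
      ∃ x, L x = Sum.elim w fun _ => t) :
    (border M v a).rank + Module.finrank F V = Fintype.card ι + 1 := by
  have hr : LinearMap.range L = LinearMap.ker (border M v a).mulVecLin := by
    ext y
    have hy : y = Sum.elim (y ∘ Sum.inl) (fun _ => y (Sum.inr ())) := by
      ext (i | i) <;> rfl
    rw [hy, LinearMap.mem_ker, mulVecLin_apply, h, LinearMap.mem_range]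
  rw [← LinearMap.finrank_range_of_inj hL, hr, rank_add_finrank_ker]
  simp

theorem rank_border_of_notMem_range [DecidableEq ι] {M : Matrix ι ι F} (hM : M.IsSymm) {v : ι → F}
    (hv : v ∉ LinearMap.range M.mulVecLin) (a : F) : (border M v a).rank = M.rank + 2 := by
  obtain ⟨w₀, hw₀, hvw₀⟩ := exists_mulVec_eq_zero_dotProduct_ne_zero hM hv
  let f : Module.Dual F (LinearMap.ker M.mulVecLin) :=
    (dotProductEquiv F ι v).comp (LinearMap.ker M.mulVecLin).subtype
  have hf : f ≠ 0 := fun h => hvw₀ (LinearMap.congr_fun h ⟨w₀, hw₀⟩)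
  let L : LinearMap.ker f →ₗ[F] (ι ⊕ Unit → F) :=
    { toFun := fun x => Sum.elim (x : ι → F) fun _ => 0
      map_add' := fun x y => by ext (i | i) <;> simp
      map_smul' := fun c x => by ext (i | i) <;> simp }
  have hL : Function.Injective L := fun x y hxy => by
    ext i
    exact congrFun hxy (Sum.inl i)
  have h1 := rank_border_of_finrank_range (V := LinearMap.ker f) (M := M) (v := v) (a := a) L hL (fun w t => by
    rw [border_mulVec_eq_zero_iff]
    constructor
    · rintro ⟨h1, h2⟩
      have ht : t = 0 := by
        by_contra ht
        apply hv
        refine ⟨-(t⁻¹ • w), ?_⟩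
        rw [mulVecLin_apply, mulVec_neg, mulVec_smul, eq_neg_of_add_eq_zero_left h1]
        simp [smul_smul, ht]
      subst ht
      refine ⟨⟨⟨w, by simpa using h1⟩, ?_⟩, rfl⟩
      simpa [f] using h2
    · rintro ⟨⟨⟨x, hx⟩, hx'⟩, h⟩
      have h1 : x = w := funext fun i => congrFun h (Sum.inl i)
      have h2 : 0 = t := congrFun h (Sum.inr ())
      subst h1 h2
      exact ⟨by simpa using hx, by simpa [f] using hx'⟩)
  have h2 := Module.Dual.finrank_ker_add_one_of_ne_zero hf
  have h3 := rank_add_finrank_ker M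
  omega

theorem mulVec_dotProduct_eq {M : Matrix ι ι F} (hM : M.IsSymm) (u w : ι → F) :
    M *ᵥ u ⬝ᵥ w = u ⬝ᵥ M *ᵥ w := by
  rw [dotProduct_mulVec, ← mulVec_transpose, hM]

theorem rank_border_mulVec_of_ne {M : Matrix ι ι F} (hM : M.IsSymm) (u : ι → F) {a : F}
    (ha : a ≠ u ⬝ᵥ M *ᵥ u) : (border M (M *ᵥ u) a).rank = M.rank + 1 := by
  let L : LinearMap.ker M.mulVecLin →ₗ[F] (ι ⊕ Unit → F) :=
    { toFun := fun x => Sum.elim (x : ι → F) fun _ => 0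
      map_add' := fun x y => by ext (i | i) <;> simp
      map_smul' := fun c x => by ext (i | i) <;> simp }
  have hL : Function.Injective L := fun x y hxy => by
    ext i
    exact congrFun hxy (Sum.inl i)
  have h1 := rank_border_of_finrank_range (M := M) (v := M *ᵥ u) (a := a) L hL (fun w t => by
    rw [border_mulVec_eq_zero_iff, mulVec_dotProduct_eq hM]
    constructor
    · rintro ⟨h1, h2⟩
      rw [eq_neg_of_add_eq_zero_left h1, dotProduct_neg, dotProduct_smul, smul_eq_mul] at h2
      have ht : t = 0 := by
        have : t * (a - u ⬝ᵥ M *ᵥ u) = 0 := by linear_combination h2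
        exact (mul_eq_zero.1 this).resolve_right (sub_ne_zero.2 ha)
      subst ht
      exact ⟨⟨w, by simpa using h1⟩, rfl⟩
    · rintro ⟨⟨x, hx⟩, h⟩
      have h1 : x = w := funext fun i => congrFun h (Sum.inl i)
      have h2 : 0 = t := congrFun h (Sum.inr ())
      subst h1 h2
      have hx' : M *ᵥ x = 0 := hx
      simp [hx'])
  have h3 := rank_add_finrank_ker M
  omega

theorem rank_border_mulVec_self {M : Matrix ι ι F} (hM : M.IsSymm) (u : ι → F) :
    (border M (M *ᵥ u) (u ⬝ᵥ M *ᵥ u)).rank = M.rank := by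
  let L : LinearMap.ker M.mulVecLin × F →ₗ[F] (ι ⊕ Unit → F) :=
    { toFun := fun x => Sum.elim ((x.1 : ι → F) - x.2 • u) fun _ => x.2
      map_add' := fun x y => by
        ext (i | i)
        · simp; ring
        · simp
      map_smul' := fun c x => by
        ext (i | i)
        · simp; ring
        · simp }
  have hL : Function.Injective L := fun x y hxy => by
    have h2 : x.2 = y.2 := congrFun hxy (Sum.inr ())
    refine Prod.ext ?_ h2
    ext i
    have := congrFun hxy (Sum.inl i)
    simpa [L, h2] using this
  have h1 := rank_border_of_finrank_range (M := M) (v := M *ᵥ u) (a := u ⬝ᵥ M *ᵥ u) L hL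
    (fun w t => by
    rw [border_mulVec_eq_zero_iff, mulVec_dotProduct_eq hM]
    constructor
    · rintro ⟨h1, h2⟩
      refine ⟨(⟨w + t • u, ?_⟩, t), ?_⟩
      · simpa [mulVec_add, mulVec_smul] using h1
      · simp [L]
    · rintro ⟨⟨⟨x, hx⟩, s⟩, h⟩
      have h1 : x - s • u = w := funext fun i => congrFun h (Sum.inl i)
      have h2 : s = t := congrFun h (Sum.inr ())
      have hx' : M *ᵥ x = 0 := hx
      subst h1 h2
      simp [mulVec_sub, mulVec_smul, hx', mul_comm])
  have h3 := rank_add_finrank_ker M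
  rw [Module.finrank_prod, Module.finrank_self] at h1
  omega

end Border


section SymmCount
variable (F : Type*) [Field F] (ι : Type*) [Fintype ι]

/-- The number of symmetric matrices of rank `r`. -/
noncomputable def symmRankCount (r : ℕ) : ℕ :=
  Nat.card {B : Matrix ι ι F // B.IsSymm ∧ B.rank = r}

theorem symmRankCount_eq_sum [Fintype {M : Matrix ι ι F // M.IsSymm}] (r : ℕ) :
    (symmRankCount F ι r : ℚ) = ∑ M : {M : Matrix ι ι F // M.IsSymm},
      if M.1.rank = r then 1 else 0 := by
  rw [Finset.sum_boole, symmRankCount, ← Fintype.card_subtype, ← Nat.card_eq_fintype_card,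
    Nat.card_congr (Equiv.subtypeSubtypeEquivSubtypeInter Matrix.IsSymm (fun B => B.rank = r))]

variable {F ι}

theorem symmRankCount_congr {κ : Type*} [Fintype κ] (e : ι ≃ κ) (r : ℕ) :
    symmRankCount F ι r = symmRankCount F κ r := by
  refine Nat.card_congr ((Matrix.reindex e e).subtypeEquiv fun B => ?_)
  rw [rank_reindex, reindex_apply, IsSymm, IsSymm, transpose_submatrix]
  exact and_congr_left' (reindex e e).injective.eq_iff.symm

variable (F) in
theorem symmRankCount_fin_zero (r : ℕ) :
    symmRankCount F (Fin 0) r = if r = 0 then 1 else 0 := by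
  have hrank : ∀ B : Matrix (Fin 0) (Fin 0) F, B.rank = 0 := fun B =>
    Nat.le_zero.1 (B.rank_le_card_width.trans (by simp))
  split_ifs with h
  · subst h
    rw [symmRankCount, Nat.card_eq_one_iff_unique]
    exact ⟨⟨fun _ _ => Subtype.ext (Subsingleton.elim _ _)⟩,
      ⟨⟨0, Subsingleton.elim _ _, hrank 0⟩⟩⟩
  · rw [symmRankCount, Nat.card_eq_zero]
    exact Or.inl ⟨fun B => h (B.2.2.symm.trans (hrank _))⟩

variable [Fintype F]

theorem card_range_mulVecLin (M : Matrix ι ι F) :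
    Nat.card (LinearMap.range M.mulVecLin) = Fintype.card F ^ M.rank := by
  classical
  rw [Nat.card_eq_fintype_card, Module.card_eq_pow_finrank (K := F)]
  rfl

open scoped Classical in
theorem sum_rank_border {M : Matrix ι ι F} (hM : M.IsSymm) (r : ℕ) :
    (∑ v : ι → F, ∑ a : F, if (border M v a).rank = r then (1 : ℚ) else 0) =
      (Fintype.card F : ℚ) ^ M.rank * ((if M.rank = r then 1 else 0) +
        ((Fintype.card F : ℚ) - 1) * if M.rank + 1 = r then 1 else 0) +
      ((Fintype.card F : ℚ) ^ Fintype.card ι - (Fintype.card F : ℚ) ^ M.rank) *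
        ((Fintype.card F : ℚ) * if M.rank + 2 = r then 1 else 0) := by
  set q : ℚ := (Fintype.card F : ℚ) with hq
  have key : ∀ v : ι → F, (∑ a : F, if (border M v a).rank = r then (1 : ℚ) else 0) =
      if v ∈ LinearMap.range M.mulVecLin then
        ((if M.rank = r then 1 else 0) + (q - 1) * if M.rank + 1 = r then 1 else 0)
      else q * if M.rank + 2 = r then 1 else 0 := by
    intro v
    by_cases hv : v ∈ LinearMap.range M.mulVecLin
    · rw [if_pos hv]
      obtain ⟨u, rfl⟩ := hv
      rw [mulVecLin_apply, Fintype.sum_eq_add_sum_compl (u ⬝ᵥ M *ᵥ u),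
        rank_border_mulVec_self hM]
      congr 1
      rw [Finset.sum_congr rfl (g := fun _ => if M.rank + 1 = r then (1 : ℚ) else 0)]
      · rw [Finset.sum_const, Finset.card_compl, Finset.card_singleton, nsmul_eq_mul,
          Nat.cast_sub Fintype.card_pos, Nat.cast_one]
      · intro a ha
        rw [rank_border_mulVec_of_ne hM]
        simpa using ha
    · rw [if_neg hv]
      simp_rw [rank_border_of_notMem_range hM hv]
      rw [Finset.sum_const, nsmul_eq_mul, Finset.card_univ]
  simp_rw [key]
  rw [Finset.sum_ite, Finset.sum_const, Finset.sum_const, nsmul_eq_mul, nsmul_eq_mul]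
  have h1 : ((Finset.univ.filter fun v : ι → F => v ∈ LinearMap.range M.mulVecLin).card : ℚ) =
      q ^ M.rank := by
    rw [← Fintype.card_subtype, ← Nat.card_eq_fintype_card]
    rw [hq, ← Nat.cast_pow, ← card_range_mulVecLin M]
  have h2 : ((Finset.univ.filter fun v : ι → F => v ∉ LinearMap.range M.mulVecLin).card : ℚ) =
      q ^ Fintype.card ι - q ^ M.rank := by
    rw [← h1, eq_sub_iff_add_eq', ← Nat.cast_add, Finset.card_filter_add_card_filter_not]
    simp [hq]
  rw [h1, h2]

variable (F ι) in
/-- A symmetric matrix on `ι ⊕ Unit` is a bordering of a symmetric matrix on `ι`. -/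
def borderEquiv : {M : Matrix ι ι F // M.IsSymm} × (ι → F) × F ≃
    {S : Matrix (ι ⊕ Unit) (ι ⊕ Unit) F // S.IsSymm} where
  toFun x := ⟨border x.1.1 x.2.1 x.2.2, by
    rw [border, isSymm_fromBlocks_iff]
    exact ⟨x.1.2, rfl, rfl, rfl⟩⟩
  invFun S := (⟨S.1.toBlocks₁₁, by
    ext i j
    exact S.2.apply _ _⟩, fun i => S.1 (Sum.inl i) (Sum.inr ()), S.1 (Sum.inr ()) (Sum.inr ()))
  left_inv x := rfl
  right_inv S := by
    ext (i | i) (j | j)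
    · rfl
    · rfl
    · exact S.2.apply _ _
    · rfl

open scoped Classical in
theorem symmRankCount_sum_unit (r : ℕ) :
    (symmRankCount F (ι ⊕ Unit) r : ℚ) = ∑ M : {M : Matrix ι ι F // M.IsSymm},
      ((Fintype.card F : ℚ) ^ M.1.rank * ((if M.1.rank = r then 1 else 0) +
        ((Fintype.card F : ℚ) - 1) * if M.1.rank + 1 = r then 1 else 0) +
      ((Fintype.card F : ℚ) ^ Fintype.card ι - (Fintype.card F : ℚ) ^ M.1.rank) *
        ((Fintype.card F : ℚ) * if M.1.rank + 2 = r then 1 else 0)) := by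
  rw [symmRankCount_eq_sum]
  refine (Fintype.sum_equiv (borderEquiv F ι) (fun x => if (border x.1.1 x.2.1 x.2.2).rank = r
    then (1 : ℚ) else 0) _ fun _ => rfl).symm.trans ?_
  rw [Fintype.sum_prod_type]
  refine Finset.sum_congr rfl fun M _ => ?_
  rw [Fintype.sum_prod_type]
  exact sum_rank_border M.2 r

theorem symmRankCount_sum_unit_zero :
    (symmRankCount F (ι ⊕ Unit) 0 : ℚ) = symmRankCount F ι 0 := by
  classical
  rw [symmRankCount_sum_unit, symmRankCount_eq_sum]
  refine Finset.sum_congr rfl fun M _ => ?_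
  by_cases h : M.1.rank = 0 <;> simp [h]

theorem symmRankCount_sum_unit_one :
    (symmRankCount F (ι ⊕ Unit) 1 : ℚ) = (Fintype.card F : ℚ) * symmRankCount F ι 1 +
      ((Fintype.card F : ℚ) - 1) * symmRankCount F ι 0 := by
  classical
  rw [symmRankCount_sum_unit, symmRankCount_eq_sum, symmRankCount_eq_sum, Finset.mul_sum,
    Finset.mul_sum, ← Finset.sum_add_distrib]
  refine Finset.sum_congr rfl fun M _ => ?_
  by_cases h : M.1.rank = 0
  · simp [h]
  · by_cases h' : M.1.rank = 1 <;> simp [h, h']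

theorem symmRankCount_sum_unit_add_two (r : ℕ) :
    (symmRankCount F (ι ⊕ Unit) (r + 2) : ℚ) =
      (Fintype.card F : ℚ) ^ (r + 2) * symmRankCount F ι (r + 2) +
      (Fintype.card F : ℚ) ^ (r + 1) * ((Fintype.card F : ℚ) - 1) * symmRankCount F ι (r + 1) +
      ((Fintype.card F : ℚ) ^ Fintype.card ι - (Fintype.card F : ℚ) ^ r) * (Fintype.card F : ℚ) *
        symmRankCount F ι r := by
  classical
  rw [symmRankCount_sum_unit, symmRankCount_eq_sum, symmRankCount_eq_sum, symmRankCount_eq_sum,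
    Finset.mul_sum, Finset.mul_sum, Finset.mul_sum, ← Finset.sum_add_distrib,
    ← Finset.sum_add_distrib]
  refine Finset.sum_congr rfl fun M _ => ?_
  by_cases h : M.1.rank = r
  · simp [h]
  · by_cases h' : M.1.rank = r + 1
    · simp [h']
    · by_cases h'' : M.1.rank = r + 2 <;> simp [h, h', h'']

theorem prod_Icc_one_eq_prod_range (f : ℕ → ℚ) (s : ℕ) :
    ∏ i ∈ Finset.Icc 1 s, f i = ∏ i ∈ Finset.range s, f (i + 1) := by
  rw [Finset.range_eq_Ico, Finset.prod_Ico_add']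
  rfl

theorem prod_pow_mul_inv_pow_sub_one {q : ℚ} (hq : q ≠ 0) {d k : ℕ} (hk : k ≤ d) :
    ∏ i ∈ Finset.range k, (q ^ d * q⁻¹ ^ i - 1) =
      ∏ i ∈ Finset.range k, (q ^ (d - i) - 1) := by
  refine Finset.prod_congr rfl fun i hi => ?_
  rw [pow_sub₀ q hq ((Finset.mem_range.1 hi).le.trans hk), inv_pow]

theorem prod_pow_mul_inv_pow_sub_one_succ {q : ℚ} (hq : q ≠ 0) (d k : ℕ) :
    ∏ i ∈ Finset.range (k + 1), (q ^ (d + 1) * q⁻¹ ^ i - 1) =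
      (q ^ (d + 1) - 1) * ∏ i ∈ Finset.range k, (q ^ d * q⁻¹ ^ i - 1) := by
  rw [Finset.prod_range_succ', mul_comm]
  congr 1
  · simp
  · refine Finset.prod_congr rfl fun i _ => ?_
    rw [pow_succ q, pow_succ q⁻¹]
    field_simp

variable (F) in
theorem symmRankCount_fin (d s : ℕ) :
    (symmRankCount F (Fin d) (2 * s) : ℚ) =
      (∏ i ∈ Finset.range s, ((Fintype.card F : ℚ) ^ (2 * (i + 1)) /
          ((Fintype.card F : ℚ) ^ (2 * (i + 1)) - 1))) *
        ∏ i ∈ Finset.range (2 * s), ((Fintype.card F : ℚ) ^ d * (Fintype.card F : ℚ)⁻¹ ^ i - 1) ∧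
    (symmRankCount F (Fin d) (2 * s + 1) : ℚ) =
      (∏ i ∈ Finset.range s, ((Fintype.card F : ℚ) ^ (2 * (i + 1)) /
          ((Fintype.card F : ℚ) ^ (2 * (i + 1)) - 1))) *
        ∏ i ∈ Finset.range (2 * s + 1),
          ((Fintype.card F : ℚ) ^ d * (Fintype.card F : ℚ)⁻¹ ^ i - 1) := by
  have hq1 : (1 : ℚ) < Fintype.card F := by exact_mod_cast Fintype.one_lt_card
  set q : ℚ := (Fintype.card F : ℚ) with hq
  have hq0 : q ≠ 0 := by positivity
  induction d generalizing s with
  | zero =>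
    have hzero : ∀ k, ∏ i ∈ Finset.range (k + 1), (q ^ 0 * q⁻¹ ^ i - 1) = 0 := fun k =>
      Finset.prod_eq_zero (i := 0) (by simp) (by simp)
    rw [symmRankCount_fin_zero, symmRankCount_fin_zero, hzero]
    rcases s with _ | s
    · simp
    · rw [show 2 * (s + 1) = 2 * s + 1 + 1 by ring, hzero]
      simp
  | succ d ih =>
    rw [symmRankCount_congr (finSumFinEquiv.symm.trans (Equiv.sumCongr (Equiv.refl (Fin d))
      (Equiv.equivPUnit (Fin 1)))), symmRankCount_congr (finSumFinEquiv.symm.trans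
      (Equiv.sumCongr (Equiv.refl (Fin d)) (Equiv.equivPUnit (Fin 1))))]
    have hodd : ∀ k, ∏ i ∈ Finset.range (k + 1), (q ^ (d + 1) * q⁻¹ ^ i - 1) = _ :=
      prod_pow_mul_inv_pow_sub_one_succ hq0 d
    rcases s with _ | s
    · have h0 := (ih 0).1
      have h1 := (ih 0).2
      simp only [mul_zero, zero_add] at h0 h1 ⊢
      rw [symmRankCount_sum_unit_zero, symmRankCount_sum_unit_one, h0, h1]
      simp [← hq]
      ring
    · have hx : q ^ (2 * (s + 1)) - 1 ≠ 0 :=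
        sub_ne_zero.2 (one_lt_pow₀ hq1 (by omega)).ne'
      have h0 := ih s
      have h1 := ih (s + 1)
      rw [show 2 * (s + 1) = 2 * s + 2 by ring] at h1 hx ⊢
      rw [symmRankCount_sum_unit_add_two, show 2 * s + 2 + 1 = 2 * s + 1 + 2 by ring,
        symmRankCount_sum_unit_add_two, h0.1, h0.2, h1.1,
        show 2 * s + 1 + 2 = 2 * s + 2 + 1 by ring, h1.2, hodd,
        show 2 * s + 2 = 2 * s + 1 + 1 by ring, hodd]
      simp only [Fintype.card_fin, ← hq, Finset.prod_range_succ _ s,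
        Finset.prod_range_succ _ (2 * s + 1 + 1),
        Finset.prod_range_succ _ (2 * s + 1), Finset.prod_range_succ _ (2 * s)]
      rw [show 2 * (s + 1) = 2 * s + 2 by ring]
      generalize ∏ i ∈ Finset.range s, (q ^ (2 * (i + 1)) / (q ^ (2 * (i + 1)) - 1)) = P
      generalize ∏ i ∈ Finset.range (2 * s), (q ^ d * q⁻¹ ^ i - 1) = Q
      simp only [pow_succ, inv_pow] at hx ⊢
      replace hx : q ^ (2 * s) * q ^ 2 - 1 ≠ 0 := by rwa [sq, ← mul_assoc]
      have hy : q ^ (2 * s) ≠ 0 := pow_ne_zero _ hq0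
      generalize q ^ (2 * s) = y at hx hy ⊢
      generalize q ^ d = x
      constructor
      · field_simp
        ring
      · field_simp
        ring

variable (F) in
theorem symmRankCount_fin_two_mul {d s : ℕ} (hs : 2 * s ≤ d) :
    (symmRankCount F (Fin d) (2 * s) : ℚ) =
      (∏ i ∈ Finset.Icc 1 s, ((Fintype.card F : ℚ) ^ (2 * i) /
          ((Fintype.card F : ℚ) ^ (2 * i) - 1))) *
        ∏ i ∈ Finset.range (2 * s), ((Fintype.card F : ℚ) ^ (d - i) - 1) := by
  rw [(symmRankCount_fin F d s).1, prod_Icc_one_eq_prod_range]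
  congr 1
  exact prod_pow_mul_inv_pow_sub_one (Nat.cast_ne_zero.2 Fintype.card_ne_zero) hs

variable (F) in
theorem symmRankCount_fin_two_mul_add_one {d s : ℕ} (hs : 2 * s + 1 ≤ d) :
    (symmRankCount F (Fin d) (2 * s + 1) : ℚ) =
      (∏ i ∈ Finset.Icc 1 s, ((Fintype.card F : ℚ) ^ (2 * i) /
          ((Fintype.card F : ℚ) ^ (2 * i) - 1))) *
        ∏ i ∈ Finset.range (2 * s + 1), ((Fintype.card F : ℚ) ^ (d - i) - 1) := by
  rw [(symmRankCount_fin F d s).2, prod_Icc_one_eq_prod_range]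
  congr 1
  exact prod_pow_mul_inv_pow_sub_one (Nat.cast_ne_zero.2 Fintype.card_ne_zero) hs

end SymmCount

section Irreducible
variable {G : Type} [Group G]

theorem exists_isIrreducible_subrepresentation {X : Type} [AddCommGroup X] [Module ℂ X]
    [FiniteDimensional ℂ X] {ρ : Representation ℂ G X} {S : Subrepresentation ρ} (hS : S ≠ ⊥) :
    ∃ T ≤ S, T.toRepresentation.IsIrreducible := by
  have hmono : StrictMono (Subrepresentation.toSubmodule : Subrepresentation ρ → Submodule ℂ X) :=
    Monotone.strictMono_of_injective (fun _ _ h => h) Subrepresentation.toSubmodule_injective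
  have : WellFoundedLT (Subrepresentation ρ) := hmono.wellFoundedLT
  have : IsAtomic (Subrepresentation ρ) := isAtomic_of_orderBot_wellFounded_lt wellFounded_lt
  obtain ⟨T, hT, hTS⟩ := (eq_bot_or_exists_atom_le S).resolve_left hS
  refine ⟨T, hTS, ?_⟩
  have hmem : ∀ U : Subrepresentation T.toRepresentation, U = ⊥ ∨ U = ⊤ := by
    intro U
    let U' : Subrepresentation ρ :=
      { toSubmodule := U.toSubmodule.map T.toSubmodule.subtype
        apply_mem_toSubmodule := by
          rintro g _ ⟨x, hx, rfl⟩
          exact ⟨_, U.apply_mem_toSubmodule g hx, rfl⟩ }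
    have hle : U' ≤ T := by
      rintro _ ⟨x, -, rfl⟩
      exact x.2
    rcases hT.le_iff.1 hle with h | h
    · left
      apply Subrepresentation.toSubmodule_injective
      have h' : U.toSubmodule.map T.toSubmodule.subtype = ⊥ :=
        congrArg Subrepresentation.toSubmodule h
      change U.toSubmodule = ⊥
      apply Submodule.map_injective_of_injective T.toSubmodule.subtype_injective
      rw [h', Submodule.map_bot]
    · right
      apply Subrepresentation.toSubmodule_injective
      have h' : U.toSubmodule.map T.toSubmodule.subtype = T.toSubmodule :=
        congrArg Subrepresentation.toSubmodule h
      change U.toSubmodule = ⊤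
      apply Submodule.map_injective_of_injective T.toSubmodule.subtype_injective
      rw [h', Submodule.map_subtype_top]
  have hne : (⊥ : Subrepresentation T.toRepresentation) ≠ ⊤ := by
    intro h
    apply hT.1
    apply Subrepresentation.toSubmodule_injective
    have h' : (⊥ : Submodule ℂ T.toSubmodule) = ⊤ := congrArg Subrepresentation.toSubmodule h
    have h2 := congrArg (Submodule.map T.toSubmodule.subtype) h'
    rw [Submodule.map_subtype_top, Submodule.map_bot] at h2
    exact h2.symm
  exact { toNontrivial := ⟨_, _, hne⟩, eq_bot_or_eq_top := hmem }

theorem eq_smul_one_of_commute (V : FDRep ℂ G) [CategoryTheory.Simple V] (f : V →ₗ[ℂ] V)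
    (hf : ∀ g, V.ρ g ∘ₗ f = f ∘ₗ V.ρ g) : ∃ c : ℂ, f = c • LinearMap.id := by
  have h1 : Module.finrank ℂ (Representation.linHom V.ρ V.ρ).invariants = 1 := by
    rw [(Representation.linHom.invariantsEquivFDRepHom V V).finrank_eq]
    exact CategoryTheory.finrank_endomorphism_simple_eq_one ℂ V
  have hmem : ∀ f : V →ₗ[ℂ] V, (∀ g, V.ρ g ∘ₗ f = f ∘ₗ V.ρ g) →
      f ∈ (Representation.linHom V.ρ V.ρ).invariants := fun f hf g => by
    rw [Representation.linHom_apply, ← LinearMap.comp_assoc, hf, LinearMap.comp_assoc]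
    change f ∘ₗ (V.ρ g * V.ρ g⁻¹) = f
    rw [← map_mul, mul_inv_cancel, map_one]
    rfl
  have hid : (⟨LinearMap.id, hmem _ fun g => rfl⟩ :
      (Representation.linHom V.ρ V.ρ).invariants) ≠ 0 := by
    intro h
    apply CategoryTheory.id_nonzero V
    have h2 := congrArg (Representation.linHom.invariantsEquivFDRepHom V V) h
    rw [map_zero] at h2
    exact h2
  obtain ⟨c, hc⟩ := (finrank_eq_one_iff_of_nonzero' _ hid).1 h1 ⟨f, hmem f hf⟩
  exact ⟨c, (congrArg Subtype.val hc).symm⟩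

variable [Fintype G]

theorem simple_of_isIrreducible {X : Type} [AddCommGroup X] [Module ℂ X]
    [FiniteDimensional ℂ X] (ρ : Representation ℂ G X) [ρ.IsIrreducible] :
    CategoryTheory.Simple (FDRep.of ρ) := by
  classical
  have hne : (Nat.card G : ℂ) ≠ 0 := Nat.cast_ne_zero.2 Nat.card_pos.ne'
  have := invertibleOfNonzero hne
  rw [FDRep.simple_iff_char_is_norm_one]
  have h := Representation.char_orthonormal ρ ρ
  rw [if_pos ⟨Representation.Equiv.refl ρ⟩, inv_mul_eq_one₀ hne] at h
  exact h.symm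

theorem finrank_ne_zero_of_simple (V : FDRep ℂ G) [hV : CategoryTheory.Simple V] :
    Module.finrank ℂ V ≠ 0 := by
  intro h
  have h1 := (FDRep.simple_iff_char_is_norm_one V).1 hV
  have h2 : ∀ g, V.character g = 0 := fun g => by
    have : Subsingleton V := Module.finrank_zero_iff.1 h
    rw [FDRep.character, Subsingleton.elim (V.ρ g) 0, map_zero]
  simp only [h2, zero_mul, Finset.sum_const_zero] at h1
  exact Nat.card_pos.ne' (Nat.cast_eq_zero.1 h1.symm)

end Irreducible

section TwoStep
variable {W Z : Type} [AddCommGroup W] [AddCommGroup Z]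

/-- The radical of the pairing `(v, w) ↦ θ (ω v w)`. -/
def pairingRadical (ω : W →+ W →+ Z) (θ : AddChar Z ℂ) : AddSubgroup W where
  carrier := {v | ∀ w, θ (ω v w) = 1}
  zero_mem' w := by simp
  add_mem' {v v'} hv hv' w := by
    rw [map_add, AddMonoidHom.add_apply, AddChar.map_add_eq_mul, hv, hv', one_mul]
  neg_mem' {v} hv w := by
    rw [map_neg, AddMonoidHom.neg_apply, AddChar.map_neg_eq_inv, hv, inv_one]

/-- Coordinates identifying a group with the central extension of `W` by `Z` with cocycle `ω`. -/
structure CentralCoords (G : Type) [Group G] (ω : W →+ W →+ Z) where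
  /-- The coordinate in the abelian quotient. -/
  vec : G → W
  /-- The coordinate in the central subgroup. -/
  ctr : G → Z
  vec_mul : ∀ g h, vec (g * h) = vec g + vec h
  ctr_mul : ∀ g h, ctr (g * h) = ctr g + ctr h + ω (vec g) (vec h)
  bijective : Function.Bijective fun g => (vec g, ctr g)

namespace CentralCoords
variable {G : Type} [Group G] {ω : W →+ W →+ Z} (E : CentralCoords G ω)

/-- The group element with given coordinates. -/
noncomputable def elt (v : W) (z : Z) : G := (Equiv.ofBijective _ E.bijective).symm (v, z)

theorem vec_elt (v : W) (z : Z) : E.vec (E.elt v z) = v :=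
  congrArg Prod.fst ((Equiv.ofBijective _ E.bijective).apply_symm_apply (v, z))

theorem ctr_elt (v : W) (z : Z) : E.ctr (E.elt v z) = z :=
  congrArg Prod.snd ((Equiv.ofBijective _ E.bijective).apply_symm_apply (v, z))

theorem ext {g h : G} (h₁ : E.vec g = E.vec h) (h₂ : E.ctr g = E.ctr h) : g = h :=
  E.bijective.1 (Prod.ext h₁ h₂)

theorem vec_one : E.vec 1 = 0 := by
  simpa using E.vec_mul 1 1

theorem ctr_one : E.ctr 1 = 0 := by
  simpa [vec_one] using E.ctr_mul 1 1

theorem elt_zero_zero : E.elt 0 0 = 1 :=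
  E.ext (by rw [E.vec_one, E.vec_elt]) (by rw [E.ctr_one, E.ctr_elt])

theorem neg_of_alternating (hω : ∀ v, ω v v = 0) (v w : W) : ω w v = -ω v w := by
  have h := hω (v + w)
  simp only [map_add, AddMonoidHom.add_apply, hω, zero_add, add_zero] at h
  exact eq_neg_of_add_eq_zero_left h

theorem mul_comm_elt (hω : ∀ v, ω v v = 0) (g h : G) :
    g * h = h * g * E.elt 0 (ω (E.vec g) (E.vec h + E.vec h)) := by
  apply E.ext
  · simp only [E.vec_mul, E.vec_elt]
    abel
  · simp only [E.vec_mul, E.ctr_mul, E.vec_elt, E.ctr_elt,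
      neg_of_alternating hω (E.vec g) (E.vec h), map_add, map_zero]
    abel

open scoped Classical in
/-- The linear character of the preimage of the radical attached to `θ` and `μ`, extended by
zero. -/
noncomputable def lam (θ : AddChar Z ℂ) (μ : AddChar (pairingRadical ω θ) ℂ) (g : G) : ℂ :=
  if h : E.vec g ∈ pairingRadical ω θ then μ ⟨E.vec g, h⟩ * θ (E.ctr g) else 0

variable {θ : AddChar Z ℂ} (μ : AddChar (pairingRadical ω θ) ℂ)

theorem lam_of_mem {g : G} (h : E.vec g ∈ pairingRadical ω θ) :
    E.lam θ μ g = μ ⟨E.vec g, h⟩ * θ (E.ctr g) := dif_pos h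

theorem lam_of_notMem {g : G} (h : E.vec g ∉ pairingRadical ω θ) : E.lam θ μ g = 0 := dif_neg h

theorem lam_elt_zero (z : Z) : E.lam θ μ (E.elt 0 z) = θ z := by
  have h : E.vec (E.elt 0 z) ∈ pairingRadical ω θ := by
    rw [E.vec_elt]; exact zero_mem _
  rw [E.lam_of_mem μ h, E.ctr_elt]
  have : (⟨E.vec (E.elt 0 z), h⟩ : pairingRadical ω θ) = 0 := Subtype.ext (E.vec_elt 0 z)
  rw [this, AddChar.map_zero_eq_one, one_mul]

theorem lam_one : E.lam θ μ 1 = 1 := by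
  rw [← E.elt_zero_zero, lam_elt_zero, AddChar.map_zero_eq_one]

theorem lam_mul {g : G} (hg : E.vec g ∈ pairingRadical ω θ) (h : G) :
    E.lam θ μ (g * h) = E.lam θ μ g * E.lam θ μ h := by
  by_cases hh : E.vec h ∈ pairingRadical ω θ
  · have hgh : E.vec (g * h) ∈ pairingRadical ω θ := by
      rw [E.vec_mul]; exact add_mem hg hh
    rw [E.lam_of_mem μ hg, E.lam_of_mem μ hh, E.lam_of_mem μ hgh]
    have : (⟨E.vec (g * h), hgh⟩ : pairingRadical ω θ) = ⟨E.vec g, hg⟩ + ⟨E.vec h, hh⟩ :=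
      Subtype.ext (E.vec_mul g h)
    rw [this, E.ctr_mul, AddChar.map_add_eq_mul, AddChar.map_add_eq_mul, AddChar.map_add_eq_mul,
      hg, mul_one]
    ring
  · rw [E.lam_of_notMem μ hh, mul_zero, E.lam_of_notMem]
    rwa [E.vec_mul, add_mem_cancel_left hg]

theorem lam_mul_comm (hω : ∀ v, ω v v = 0) {g : G} (hg : E.vec g ∈ pairingRadical ω θ) (h : G) :
    E.lam θ μ (h * g) = E.lam θ μ g * E.lam θ μ h := by
  rw [← E.lam_mul μ hg, E.mul_comm_elt hω h g]
  have hz : E.vec (E.elt 0 (ω (E.vec h) (E.vec g + E.vec g))) ∈ pairingRadical ω θ := by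
    rw [E.vec_elt]; exact zero_mem _
  have hθ : θ (ω (E.vec h) (E.vec g + E.vec g)) = 1 := by
    rw [neg_of_alternating hω (E.vec g + E.vec g), AddChar.map_neg_eq_inv,
      add_mem hg hg (E.vec h), inv_one]
  have hcomm := E.mul_comm_elt hω (g * h) (E.elt 0 (ω (E.vec h) (E.vec g + E.vec g)))
  rw [E.vec_elt, add_zero, map_zero] at hcomm
  rw [hcomm, E.elt_zero_zero, mul_one, E.lam_mul μ hz, E.lam_elt_zero, hθ, one_mul]

/-- `V` lies over `(θ, μ)` when the preimage of the radical acts through the scalars `lam θ μ`. -/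
def LiesOver (V : FDRep ℂ G) (θ : AddChar Z ℂ) (μ : AddChar (pairingRadical ω θ) ℂ) : Prop :=
  ∀ g, E.vec g ∈ pairingRadical ω θ → V.ρ g = E.lam θ μ g • LinearMap.id

theorem exists_liesOver [Fintype G] (hω : ∀ v, ω v v = 0) (V : FDRep ℂ G)
    [CategoryTheory.Simple V] :
    ∃ θ μ, E.LiesOver V θ μ := by
  have hV := finrank_ne_zero_of_simple V
  have : Nontrivial V := Module.nontrivial_of_finrank_pos (Nat.pos_of_ne_zero hV)
  obtain ⟨x, hx⟩ := exists_ne (0 : V)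
  have hinj : ∀ c c' : ℂ, c • (LinearMap.id : V →ₗ[ℂ] V) = c' • LinearMap.id → c = c' :=
    fun c c' h => smul_left_injective ℂ hx (LinearMap.congr_fun h x)
  have hcen : ∀ z, ∃ c : ℂ, V.ρ (E.elt 0 z) = c • LinearMap.id := fun z => by
    refine eq_smul_one_of_commute V _ fun g => ?_
    change V.ρ g * V.ρ _ = V.ρ _ * V.ρ g
    rw [← map_mul, ← map_mul]
    congr 1
    apply E.ext
    · simp only [E.vec_mul, E.vec_elt, add_zero, zero_add]
    · simp only [E.ctr_mul, E.vec_elt, E.ctr_elt, map_zero, AddMonoidHom.zero_apply]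
      abel
  choose t ht using hcen
  have helt : ∀ v v' z z', E.elt v z * E.elt v' z' = E.elt (v + v') (z + z' + ω v v') := by
    intro v v' z z'
    apply E.ext <;> simp only [E.vec_mul, E.ctr_mul, E.vec_elt, E.ctr_elt]
  let θ : AddChar Z ℂ :=
    { toFun := t
      map_zero_eq_one' := hinj _ _ (by rw [← ht, E.elt_zero_zero, map_one, one_smul]; rfl)
      map_add_eq_mul' := fun z z' => hinj _ _ (by
        have h := helt 0 0 z z'
        rw [map_zero, add_zero, add_zero] at h
        rw [← ht, ← h, map_mul, ht, ht]
        ext y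
        simp only [Module.End.mul_apply, LinearMap.smul_apply, LinearMap.id_apply, mul_smul]) }
  have hrad : ∀ v : pairingRadical ω θ, ∃ c : ℂ, V.ρ (E.elt v 0) = c • LinearMap.id := fun v => by
    refine eq_smul_one_of_commute V _ fun g => ?_
    change V.ρ g * V.ρ _ = V.ρ _ * V.ρ g
    rw [← map_mul, ← map_mul, E.mul_comm_elt hω (E.elt v 0) g, map_mul _ (g * _), ht]
    have h1 : t (ω (E.vec (E.elt v 0)) (E.vec g + E.vec g)) = 1 := by
      rw [E.vec_elt]
      exact v.2 _
    rw [h1, one_smul]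
    rfl
  choose m hm using hrad
  have hsplit : ∀ v z, E.elt v z = E.elt v 0 * E.elt 0 z := fun v z => by
    rw [helt, map_zero, add_zero, add_zero, zero_add]
  let μ : AddChar (pairingRadical ω θ) ℂ :=
    { toFun := m
      map_zero_eq_one' := hinj _ _ (by
        rw [← hm, AddSubgroup.coe_zero, E.elt_zero_zero, map_one, one_smul]; rfl)
      map_add_eq_mul' := fun v v' => hinj _ _ (by
        have h := helt v v' 0 0
        rw [zero_add, zero_add, hsplit (v + v') (ω v v')] at h
        have h2 := congrArg V.ρ h
        have h1 : t (ω v v') = 1 := v.2 _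
        rw [map_mul, map_mul, ht, h1, hm, hm, ← AddSubgroup.coe_add, hm, one_smul] at h2
        change _ = _ * 1 at h2
        rw [mul_one] at h2
        rw [← h2]
        ext y
        simp only [Module.End.mul_apply, LinearMap.smul_apply, LinearMap.id_apply, mul_smul]) }
  refine ⟨θ, μ, fun g hg => ?_⟩
  rw [E.lam_of_mem μ hg]
  have h1 : g = E.elt (E.vec g) 0 * E.elt 0 (E.ctr g) := by
    rw [← hsplit]
    exact E.ext (E.vec_elt _ _).symm (E.ctr_elt _ _).symm
  have h2 := hm ⟨E.vec g, hg⟩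
  conv_lhs => rw [h1, map_mul, ht]
  rw [h2]
  ext y
  simp only [Module.End.mul_apply, LinearMap.smul_apply, LinearMap.id_apply, mul_smul]
  rfl


theorem character_eq [Fintype G] (hω : ∀ v, ω v v = 0) (h2 : ∀ w : W, ∃ w', w = w' + w')
    {V : FDRep ℂ G} {θ : AddChar Z ℂ} {μ : AddChar (pairingRadical ω θ) ℂ}
    (hV : E.LiesOver V θ μ) (g : G) :
    V.character g = Module.finrank ℂ V * E.lam θ μ g := by
  by_cases hg : E.vec g ∈ pairingRadical ω θ
  · rw [FDRep.character, hV g hg, map_smul, LinearMap.trace_id, smul_eq_mul, mul_comm]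
  · rw [E.lam_of_notMem μ hg, mul_zero]
    obtain ⟨w, hw⟩ : ∃ w, θ (ω (E.vec g) w) ≠ 1 := not_forall.1 hg
    obtain ⟨w', rfl⟩ := h2 w
    have hz : E.vec (E.elt 0 (ω (E.vec g) (w' + w'))) ∈ pairingRadical ω θ := by
      rw [E.vec_elt]; exact zero_mem _
    have hcomm := E.mul_comm_elt hω g (E.elt w' 0)
    rw [E.vec_elt] at hcomm
    have h : V.character (g * E.elt w' 0 * (E.elt w' 0)⁻¹) =
        θ (ω (E.vec g) (w' + w')) * V.character g := by
      rw [hcomm, FDRep.char_mul_comm, ← mul_assoc, ← mul_assoc, inv_mul_cancel, one_mul,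
        FDRep.character, map_mul, hV _ hz, E.lam_elt_zero, mul_smul_comm, map_smul, smul_eq_mul]
      rfl
    rw [mul_inv_cancel_right] at h
    by_contra hne
    exact hw (mul_right_cancel₀ hne (by rw [one_mul]; exact h.symm))

theorem card_vec_mem (R : AddSubgroup W) :
    Nat.card {g : G // E.vec g ∈ R} = Nat.card R * Nat.card Z := by
  rw [← Nat.card_prod]
  refine Nat.card_congr (((Equiv.ofBijective _ E.bijective).subtypeEquiv
    (q := fun x : W × Z => x.1 ∈ R) fun g => Iff.rfl).trans
      (Equiv.prodSubtypeFstEquivSubtypeProd (p := fun v => v ∈ R)))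

theorem card_eq (E : CentralCoords G ω) : Nat.card G = Nat.card W * Nat.card Z := by
  rw [← Nat.card_prod]
  exact Nat.card_congr (Equiv.ofBijective _ E.bijective)

theorem finrank_sq_mul_card [Fintype G] [Finite Z] (hω : ∀ v, ω v v = 0)
    (h2 : ∀ w : W, ∃ w', w = w' + w')
    {V : FDRep ℂ G} [hs : CategoryTheory.Simple V] {θ : AddChar Z ℂ}
    {μ : AddChar (pairingRadical ω θ) ℂ} (hV : E.LiesOver V θ μ) :
    Module.finrank ℂ V ^ 2 * Nat.card (pairingRadical ω θ) = Nat.card W := by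
  classical
  have h := (FDRep.simple_iff_char_is_norm_one V).1 hs
  have hterm : ∀ g, V.character g * V.character g⁻¹ =
      if E.vec g ∈ pairingRadical ω θ then (Module.finrank ℂ V : ℂ) ^ 2 else 0 := fun g => by
    rw [E.character_eq hω h2 hV, E.character_eq hω h2 hV]
    split_ifs with hg
    · have h1 := E.lam_mul μ hg g⁻¹
      rw [mul_inv_cancel, E.lam_one] at h1
      linear_combination -(Module.finrank ℂ V : ℂ) ^ 2 * h1
    · rw [E.lam_of_notMem μ hg, mul_zero, zero_mul]
  simp only [hterm] at h
  rw [← Finset.sum_filter, Finset.sum_const, nsmul_eq_mul, ← Fintype.card_subtype,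
    ← Nat.card_eq_fintype_card, E.card_vec_mem, E.card_eq] at h
  have hZ : Nat.card Z ≠ 0 := Nat.card_pos.ne'
  apply Nat.eq_of_mul_eq_mul_right (Nat.pos_of_ne_zero hZ)
  rw [← @Nat.cast_inj ℂ]
  push_cast at h ⊢
  linear_combination h

theorem exists_simple_liesOver [Fintype G] (hω : ∀ v, ω v v = 0) (θ : AddChar Z ℂ)
    (μ : AddChar (pairingRadical ω θ) ℂ) :
    ∃ V : FDRep ℂ G, CategoryTheory.Simple V ∧ E.LiesOver V θ μ := by
  let ρ : Representation ℂ G (G → ℂ) :=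
    { toFun := fun x => LinearMap.funLeft ℂ ℂ fun g => g * x
      map_one' := by ext; simp [LinearMap.funLeft]
      map_mul' := fun x y => by
        apply LinearMap.ext
        intro f
        funext g
        simp [LinearMap.funLeft_apply, mul_assoc] }
  have hρ : ∀ x f g, ρ x f g = f (g * x) := fun _ _ _ => rfl
  let S : Subrepresentation ρ :=
    { toSubmodule :=
        { carrier := {f | ∀ g, E.vec g ∈ pairingRadical ω θ → ρ g f = E.lam θ μ g • f}
          zero_mem' := fun g _ => by rw [map_zero, smul_zero]
          add_mem' := fun {f f'} hf hf' g hg => by rw [map_add, hf g hg, hf' g hg, smul_add]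
          smul_mem' := fun c f hf g hg => by rw [map_smul, hf g hg, smul_comm] }
      apply_mem_toSubmodule := fun x f hf g hg => by
        have hz : E.vec (E.elt 0 (ω (E.vec g) (E.vec x + E.vec x))) ∈ pairingRadical ω θ := by
          rw [E.vec_elt]; exact zero_mem _
        rw [← Module.End.mul_apply, ← map_mul, E.mul_comm_elt hω g x, map_mul, map_mul,
          Module.End.mul_apply, Module.End.mul_apply, hf _ hz, E.lam_elt_zero, hg, one_smul,
          hf g hg, map_smul] }
  have hmem : E.lam θ μ ∈ S.toSubmodule := fun g hg => by
    funext h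
    rw [hρ, E.lam_mul_comm μ hω hg]
    rfl
  have hS : S ≠ ⊥ := by
    intro h
    have h0 : E.lam θ μ = 0 := by
      have h1 : S.toSubmodule = ⊥ := congrArg Subrepresentation.toSubmodule h
      rw [h1] at hmem
      exact hmem
    have h1 := E.lam_one μ
    rw [h0] at h1
    exact zero_ne_one h1
  obtain ⟨T, hTS, hT⟩ := exists_isIrreducible_subrepresentation hS
  refine ⟨FDRep.of T.toRepresentation, simple_of_isIrreducible _, fun g hg => ?_⟩
  apply LinearMap.ext
  intro x
  exact Subtype.ext (hTS x.2 g hg)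

theorem lam_injective {θ θ' : AddChar Z ℂ} {μ : AddChar (pairingRadical ω θ) ℂ}
    {μ' : AddChar (pairingRadical ω θ') ℂ} (h : E.lam θ μ = E.lam θ' μ') :
    (⟨θ, μ⟩ : Σ θ : AddChar Z ℂ, AddChar (pairingRadical ω θ) ℂ) = ⟨θ', μ'⟩ := by
  have hθ : θ = θ' := by
    ext z
    rw [← E.lam_elt_zero μ z, h, E.lam_elt_zero]
  subst hθ
  congr 1
  ext v
  have hv : E.vec (E.elt v 0) ∈ pairingRadical ω θ := by
    rw [E.vec_elt]; exact v.2
  have h1 := congrFun h (E.elt v 0)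
  rw [E.lam_of_mem μ hv, E.lam_of_mem μ' hv, E.ctr_elt, AddChar.map_zero_eq_one, mul_one,
    mul_one] at h1
  have h2 : (⟨E.vec (E.elt v 0), hv⟩ : pairingRadical ω θ) = v := Subtype.ext (E.vec_elt _ _)
  rwa [h2] at h1

theorem exists_simple_character_one_iff (E : CentralCoords G ω) [Fintype G] [Finite Z]
    (hω : ∀ v, ω v v = 0)
    (h2 : ∀ w : W, ∃ w', w = w' + w') (m : ℕ) :
    (∃ V : FDRep ℂ G, CategoryTheory.Simple V ∧ V.character 1 = (m : ℂ)) ↔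
      ∃ θ : AddChar Z ℂ, m ^ 2 * Nat.card (pairingRadical ω θ) = Nat.card W := by
  have : Finite W := Finite.of_surjective E.vec fun v => ⟨E.elt v 0, E.vec_elt v 0⟩
  constructor
  · rintro ⟨V, hV, h⟩
    obtain ⟨θ, μ, hθ⟩ := E.exists_liesOver hω V
    rw [FDRep.char_one, Nat.cast_inj] at h
    exact ⟨θ, h ▸ E.finrank_sq_mul_card hω h2 hθ⟩
  · rintro ⟨θ, h⟩
    obtain ⟨V, hV, hθ⟩ := E.exists_simple_liesOver hω θ 1
    refine ⟨V, hV, ?_⟩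
    rw [FDRep.char_one, Nat.cast_inj]
    have h' := E.finrank_sq_mul_card hω h2 hθ
    exact Nat.pow_left_injective two_ne_zero
      (Nat.eq_of_mul_eq_mul_right Nat.card_pos (h'.trans h.symm))

theorem card_characters (E : CentralCoords G ω) [Fintype G] [Finite Z] (hω : ∀ v, ω v v = 0)
    (h2 : ∀ w : W, ∃ w', w = w' + w') {D R : ℕ} (hD : D ^ 2 * R = Nat.card W) :
    Nat.card {χ : G → ℂ | (∃ V : FDRep ℂ G, CategoryTheory.Simple V ∧ V.character = χ) ∧
        χ 1 = (D : ℂ)} =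
      R * Nat.card {θ : AddChar Z ℂ // Nat.card (pairingRadical ω θ) = R} := by
  have : Finite W := Finite.of_surjective E.vec fun v => ⟨E.elt v 0, E.vec_elt v 0⟩
  have hpos : 0 < D ^ 2 * R := hD ▸ Nat.card_pos
  have hR : 0 < R := Nat.pos_of_mul_pos_left hpos
  have hD0 : 0 < D := Nat.pos_of_ne_zero fun h => by simp [h] at hpos
  let f : (Σ θ : {θ : AddChar Z ℂ // Nat.card (pairingRadical ω θ) = R},
      AddChar (pairingRadical ω θ.1) ℂ) →
      {χ : G → ℂ | (∃ V : FDRep ℂ G, CategoryTheory.Simple V ∧ V.character = χ) ∧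
        χ 1 = (D : ℂ)} := fun x =>
    ⟨fun g => D * E.lam x.1.1 x.2 g, by
      obtain ⟨V, hV, hθ⟩ := E.exists_simple_liesOver hω x.1.1 x.2
      have h' := E.finrank_sq_mul_card hω h2 hθ
      rw [x.1.2, ← hD] at h'
      have h3 : Module.finrank ℂ V = D :=
        Nat.pow_left_injective two_ne_zero (Nat.eq_of_mul_eq_mul_right hR h')
      refine ⟨⟨V, hV, ?_⟩, ?_⟩
      · funext g
        rw [E.character_eq hω h2 hθ, h3]
      · change (D : ℂ) * E.lam x.1.1 x.2 1 = D
        rw [E.lam_one, mul_one]⟩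
  have hf : Function.Bijective f := by
    constructor
    · rintro ⟨⟨θ, hθ⟩, μ⟩ ⟨⟨θ', hθ'⟩, μ'⟩ h
      have h1 : E.lam θ μ = E.lam θ' μ' := by
        funext g
        exact mul_left_cancel₀ (Nat.cast_ne_zero.2 hD0.ne') (congrFun (congrArg Subtype.val h) g)
      have h3 := E.lam_injective h1
      rw [Sigma.mk.injEq] at h3
      obtain ⟨rfl, h4⟩ := h3
      rw [eq_of_heq h4]
    · rintro ⟨_, ⟨V, hV, rfl⟩, h1⟩
      obtain ⟨θ, μ, hθ⟩ := E.exists_liesOver hω V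
      rw [FDRep.char_one, Nat.cast_inj] at h1
      have h' := E.finrank_sq_mul_card hω h2 hθ
      rw [h1, ← hD] at h'
      refine ⟨⟨⟨θ, Nat.eq_of_mul_eq_mul_left (pow_pos hD0 2) h'⟩, μ⟩, Subtype.ext ?_⟩
      funext g
      change (D : ℂ) * E.lam θ μ g = V.character g
      rw [E.character_eq hω h2 hθ, h1]
  rw [← Nat.card_congr (Equiv.ofBijective f hf), Nat.card_sigma]
  have hcard : ∀ θ : {θ : AddChar Z ℂ // Nat.card (pairingRadical ω θ) = R},
      Nat.card (AddChar (pairingRadical ω θ.1) ℂ) = R := fun θ => by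
    have := Fintype.ofFinite (pairingRadical ω θ.1)
    rw [Nat.card_eq_fintype_card, AddChar.card_eq, ← Nat.card_eq_fintype_card, θ.2]
  simp only [hcard]
  simp [Nat.card_eq_fintype_card, mul_comm]

end CentralCoords
end TwoStep

section Concrete
variable (F : Type) [Field F] (d m : ℕ)

/-- The additive group of symmetric `d×d` matrices. -/
def symmMat : AddSubgroup (Matrix (Fin d) (Fin d) F) where
  carrier := {X | X.IsSymm}
  zero_mem' := Matrix.isSymm_zero
  add_mem' h h' := h.add h'
  neg_mem' h := h.neg

/-- The space of pairs of `d×m` matrices. -/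
abbrev MatPair := Matrix (Fin d) (Fin m) F × Matrix (Fin d) (Fin m) F

variable {F d m}

/-- The alternating form on pairs of matrices describing the commutators of `R_u^{C,d}`. -/
def commForm : MatPair F d m →+ MatPair F d m →+ symmMat F d :=
  AddMonoidHom.mk' (fun v => AddMonoidHom.mk' (fun w =>
    ⟨(2⁻¹ : F) • (v.1 * w.2ᵀ + w.2 * v.1ᵀ - w.1 * v.2ᵀ - v.2 * w.1ᵀ), by
      change (_ : Matrix (Fin d) (Fin d) F)ᵀ = _
      simp only [transpose_smul, transpose_sub, transpose_add, transpose_mul, transpose_transpose]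
      congr 1
      abel⟩) fun w w' => Subtype.ext (by
      change (2⁻¹ : F) • _ = (2⁻¹ : F) • _ + (2⁻¹ : F) • _
      simp only [Prod.fst_add, Prod.snd_add, transpose_add, Matrix.mul_add, Matrix.add_mul]
      module)) fun v v' => AddMonoidHom.ext fun w => Subtype.ext (by
      change (2⁻¹ : F) • _ = (2⁻¹ : F) • _ + (2⁻¹ : F) • _
      simp only [Prod.fst_add, Prod.snd_add, transpose_add, Matrix.mul_add, Matrix.add_mul]
      module)

theorem coe_commForm (v w : MatPair F d m) : (commForm v w : Matrix (Fin d) (Fin d) F) =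
    (2⁻¹ : F) • (v.1 * w.2ᵀ + w.2 * v.1ᵀ - w.1 * v.2ᵀ - v.2 * w.1ᵀ) := rfl

theorem commForm_self (v : MatPair F d m) : commForm v v = 0 := by
  apply Subtype.ext
  rw [coe_commForm]
  simp

theorem eq_zero_of_trace_char {l m : Type} [Fintype l] [Fintype m] [DecidableEq l] [DecidableEq m]
    {ψ : AddChar F ℂ} (hψ : ψ.IsPrimitive) {N : Matrix l m F}
    (h : ∀ M : Matrix m l F, ψ (M * N).trace = 1) : N = 0 := by
  apply Matrix.ext_iff_trace_mul_left.2
  intro M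
  rw [Matrix.mul_zero, Matrix.trace_zero]
  by_contra hne
  apply hψ hne
  ext c
  have h1 := h (c • M)
  rw [Matrix.smul_mul, Matrix.trace_smul, smul_eq_mul, mul_comm] at h1
  simpa [AddChar.mulShift_apply] using h1

/-- The character `X ↦ ψ (tr (B X))` of the group of symmetric matrices. -/
def traceChar (ψ : AddChar F ℂ) (B : symmMat F d) : AddChar (symmMat F d) ℂ :=
  ψ.compAddMonoidHom (AddMonoidHom.mk' (fun X => (B.1 * X.1).trace) fun X Y => by
    rw [AddSubgroup.coe_add, Matrix.mul_add, Matrix.trace_add])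

theorem traceChar_apply (ψ : AddChar F ℂ) (B X : symmMat F d) :
    traceChar ψ B X = ψ (B.1 * X.1).trace := rfl

theorem traceChar_bijective [Finite F] (hF : (2 : F) ≠ 0) {ψ : AddChar F ℂ} (hψ : ψ.IsPrimitive) :
    Function.Bijective (traceChar ψ : symmMat F d → AddChar (symmMat F d) ℂ) := by
  have := Fintype.ofFinite (symmMat F d)
  rw [Fintype.bijective_iff_injective_and_card, AddChar.card_eq]
  refine ⟨fun B B' h => ?_, rfl⟩
  apply Subtype.ext
  rw [← sub_eq_zero]
  refine eq_zero_of_trace_char hψ fun M => ?_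
  have hX : ((2⁻¹ : F) • (M + Mᵀ)) ∈ symmMat F d :=
    (Matrix.isSymm_add_transpose_self M).smul _
  have h1 := DFunLike.congr_fun h ⟨_, hX⟩
  rw [traceChar_apply, traceChar_apply] at h1
  have hN : (B.1 - B'.1)ᵀ = B.1 - B'.1 := B.2.sub B'.2
  have h2 : (M * (B.1 - B'.1)).trace =
      (B.1 * ((2⁻¹ : F) • (M + Mᵀ))).trace - (B'.1 * ((2⁻¹ : F) • (M + Mᵀ))).trace := by
    have h3 : ((B.1 - B'.1) * Mᵀ).trace = (M * (B.1 - B'.1)).trace := by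
      rw [← Matrix.trace_transpose, transpose_mul, transpose_transpose, hN]
    rw [← Matrix.trace_sub, ← Matrix.sub_mul, Matrix.mul_smul, Matrix.trace_smul, Matrix.mul_add,
      Matrix.trace_add, h3, Matrix.trace_mul_comm _ M, smul_eq_mul, ← two_mul,
      inv_mul_cancel_left₀ hF]
  rw [h2, AddChar.map_sub_eq_div, h1]
  exact div_self (ψ.val_isUnit _).ne_zero

theorem mem_pairingRadical_traceChar (hF : (2 : F) ≠ 0) {ψ : AddChar F ℂ} (hψ : ψ.IsPrimitive)
    (B : symmMat F d) (v : MatPair F d m) :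
    v ∈ pairingRadical commForm (traceChar ψ B) ↔ B.1 * v.1 = 0 ∧ B.1 * v.2 = 0 := by
  have hB : B.1ᵀ = B.1 := B.2
  have key : ∀ w : MatPair F d m, traceChar ψ B (commForm v w) =
      ψ ((w.2ᵀ * (B.1 * v.1)).trace - (w.1ᵀ * (B.1 * v.2)).trace) := by
    intro w
    rw [traceChar_apply, coe_commForm]
    have h1 : ∀ P Q : Matrix (Fin d) (Fin m) F,
        (B.1 * (P * Qᵀ)).trace = (Qᵀ * (B.1 * P)).trace := fun P Q => by
      rw [← Matrix.mul_assoc, Matrix.trace_mul_comm]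
    have h2 : ∀ P Q : Matrix (Fin d) (Fin m) F,
        (B.1 * (Q * Pᵀ)).trace = (Qᵀ * (B.1 * P)).trace := fun P Q => by
      rw [← Matrix.trace_transpose, transpose_mul, transpose_mul, transpose_transpose, hB,
        Matrix.mul_assoc, Matrix.trace_mul_comm, Matrix.mul_assoc]
    congr 1
    simp only [Matrix.mul_smul, Matrix.trace_smul, Matrix.mul_sub, Matrix.mul_add,
      Matrix.trace_sub, Matrix.trace_add, h1 v.1 w.2, h2 v.1 w.2, h2 v.2 w.1, h1 v.2 w.1,
      smul_eq_mul]
    field_simp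
    ring
  constructor
  · intro h
    constructor
    · refine eq_zero_of_trace_char hψ fun M => ?_
      have h1 := h (0, Mᵀ)
      rw [key] at h1
      simpa using h1
    · refine eq_zero_of_trace_char hψ fun M => ?_
      have h1 := h (-Mᵀ, 0)
      rw [key] at h1
      simpa using h1
  · rintro ⟨h1, h2⟩ w
    rw [key, h1, h2]
    simp

theorem card_mul_eq_zero [Fintype F] (B : Matrix (Fin d) (Fin d) F) :
    Nat.card {A : Matrix (Fin d) (Fin m) F // B * A = 0} =
      Fintype.card F ^ ((d - B.rank) * m) := by
  let e : {A : Matrix (Fin d) (Fin m) F // B * A = 0} ≃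
      (Fin m → LinearMap.ker B.mulVecLin) :=
    { toFun := fun A j => ⟨fun i => A.1 i j, by
        rw [LinearMap.mem_ker]
        funext i
        exact congrFun (congrFun A.2 i) j⟩
      invFun := fun f => ⟨fun i j => (f j).1 i, by
        ext i j
        exact congrFun (f j).2 i⟩
      left_inv := fun _ => rfl
      right_inv := fun _ => rfl }
  rw [Nat.card_congr e, Nat.card_fun, Module.natCard_eq_pow_finrank (K := F), ← pow_mul]
  have h := rank_add_finrank_ker B
  rw [Fintype.card_fin] at h
  rw [Nat.card_eq_fintype_card, Nat.card_eq_fintype_card, Fintype.card_fin,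
    Nat.eq_sub_of_add_eq' h]

theorem card_pairingRadical_traceChar [Fintype F] (hF : (2 : F) ≠ 0) {ψ : AddChar F ℂ}
    (hψ : ψ.IsPrimitive) (B : symmMat F d) :
    Nat.card (pairingRadical (commForm : MatPair F d m →+ _) (traceChar ψ B)) =
      Fintype.card F ^ (2 * ((d - B.1.rank) * m)) := by
  have e : pairingRadical (commForm : MatPair F d m →+ _) (traceChar ψ B) ≃
      {A : Matrix (Fin d) (Fin m) F // B.1 * A = 0} ×
        {A : Matrix (Fin d) (Fin m) F // B.1 * A = 0} :=
    (Equiv.subtypeEquivRight fun v => mem_pairingRadical_traceChar hF hψ B v).trans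
      (Equiv.subtypeProdEquivProd (p := fun A : Matrix (Fin d) (Fin m) F => B.1 * A = 0)
        (q := fun A : Matrix (Fin d) (Fin m) F => B.1 * A = 0))
  rw [Nat.card_congr e, Nat.card_prod, card_mul_eq_zero, ← pow_add, two_mul]

theorem card_matPair [Fintype F] : Nat.card (MatPair F d m) = Fintype.card F ^ (2 * (d * m)) := by
  have h : Nat.card (Matrix (Fin d) (Fin m) F) = Fintype.card F ^ (d * m) := by
    rw [Nat.card_eq_fintype_card, Module.card_eq_pow_finrank (K := F), Module.finrank_matrix]
    simp
  rw [Nat.card_prod, h, ← pow_add, two_mul]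

end Concrete

section Radical
variable {F : Type} [Field F] {n d : ℕ}

/-- The element of `R_u^{C,d}` with given linearizing coordinates. -/
def radMat (v : MatPair F d (n - d)) (z : symmMat F d) : Matrix (κ n d) (κ n d) F :=
  Matrix.fromBlocks (Umat F n d v.1)
    (Matrix.fromBlocks (z.1 + (2⁻¹ : F) • (v.1 * v.2ᵀ - v.2 * v.1ᵀ)) v.2 v.2ᵀ 0) 0
    (Matrix.fromBlocks 1 0 (-v.1ᵀ) 1)

theorem radMat_mul (hF : (2 : F) ≠ 0) (v v' : MatPair F d (n - d)) (z z' : symmMat F d) :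
    radMat v z * radMat v' z' = radMat (v + v') (z + z' + commForm v v') := by
  have h : z'.1 + (2⁻¹ : F) • (v'.1 * v'.2ᵀ - v'.2 * v'.1ᵀ) + v.1 * v'.2ᵀ +
      (z.1 + (2⁻¹ : F) • (v.1 * v.2ᵀ - v.2 * v.1ᵀ) + v.2 * -v'.1ᵀ) =
      z.1 + z'.1 + (2⁻¹ : F) • (v.1 * v'.2ᵀ + v'.2 * v.1ᵀ - v'.1 * v.2ᵀ - v.2 * v'.1ᵀ) +
        (2⁻¹ : F) • ((v.1 + v'.1) * (v.2 + v'.2)ᵀ - (v.2 + v'.2) * (v.1 + v'.1)ᵀ) := by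
    simp only [transpose_add, Matrix.mul_add, Matrix.add_mul, Matrix.mul_neg]
    ext i j
    simp only [Matrix.add_apply, Matrix.sub_apply, Matrix.neg_apply, Matrix.smul_apply, smul_eq_mul]
    field_simp
    ring
  simp only [radMat, Umat, Matrix.fromBlocks_multiply, Matrix.fromBlocks_add, Matrix.one_mul,
    Matrix.mul_one, Matrix.zero_mul, Matrix.mul_zero, add_zero, zero_add, AddSubgroup.coe_add,
    coe_commForm, Prod.fst_add, Prod.snd_add, h]
  congr 2 <;> simp [add_comm]

theorem radMat_zero : radMat (0 : MatPair F d (n - d)) 0 = 1 := by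
  simp [radMat, Umat]

theorem radMat_mul_neg (hF : (2 : F) ≠ 0) (v : MatPair F d (n - d)) (z : symmMat F d) :
    radMat v z * radMat (-v) (-z) = 1 := by
  rw [radMat_mul hF, map_neg, commForm_self, ← radMat_zero]
  simp

theorem radMat_injective {v v' : MatPair F d (n - d)} {z z' : symmMat F d}
    (h : radMat v z = radMat v' z') : v = v' ∧ z = z' := by
  simp only [radMat, Umat, Matrix.fromBlocks_inj] at h
  obtain ⟨⟨-, h1, -⟩, ⟨h3, h2, -⟩, -⟩ := h
  obtain rfl : v = v' := Prod.ext h1 h2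
  exact ⟨rfl, Subtype.ext (add_right_cancel h3)⟩

theorem inv_transpose_Umat (A : Matrix (Fin d) (Fin (n - d)) F) :
    ((Umat F n d A)ᵀ)⁻¹ = Matrix.fromBlocks 1 0 (-Aᵀ) 1 := by
  apply Matrix.inv_eq_right_inv
  simp [Umat, Matrix.fromBlocks_transpose, Matrix.fromBlocks_multiply]

theorem mem_RuC_iff (hF : (2 : F) ≠ 0) (g : Matrix (κ n d) (κ n d) F) :
    g ∈ RuC F n d ↔ ∃ v z, g = radMat v z := by
  have key : ∀ (A Y : Matrix (Fin d) (Fin (n - d)) F) (X : Matrix (Fin d) (Fin d) F),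
      Matrix.fromBlocks X Y Yᵀ 0 * ((Umat F n d A)ᵀ)⁻¹ =
        Matrix.fromBlocks (X - Y * Aᵀ) Y Yᵀ 0 := fun A Y X => by
    simp [inv_transpose_Umat, Matrix.fromBlocks_multiply, sub_eq_add_neg]
  have half : ∀ P Q : Matrix (Fin d) (Fin d) F,
      (2⁻¹ : F) • (P + Q) - Q = (2⁻¹ : F) • (P - Q) := fun P Q => by
    ext i j
    simp only [Matrix.add_apply, Matrix.sub_apply, Matrix.smul_apply, smul_eq_mul]
    field_simp
    ring
  constructor
  · rintro ⟨A, V, ⟨hV, h0⟩, rfl⟩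
    obtain ⟨X, Y, Y', O, rfl⟩ : ∃ X Y Y' O, V = Matrix.fromBlocks X Y Y' O :=
      ⟨_, _, _, _, (Matrix.fromBlocks_toBlocks V).symm⟩
    rw [Matrix.fromBlocks_transpose, Matrix.fromBlocks_inj] at hV
    obtain ⟨hX, -, rfl, -⟩ := hV
    obtain rfl : O = 0 := by
      ext i j
      exact h0 i j
    have hz : X - (2⁻¹ : F) • (A * Yᵀ + Y * Aᵀ) ∈ symmMat F d := by
      change (_ : Matrix (Fin d) (Fin d) F)ᵀ = _
      simp only [transpose_sub, transpose_smul, transpose_add, transpose_mul, transpose_transpose,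
        hX]
      rw [add_comm]
    refine ⟨(A, Y), ⟨_, hz⟩, ?_⟩
    rw [key, inv_transpose_Umat, radMat, ← half]
    congr 2
    exact (sub_add_sub_cancel _ _ _).symm
  · rintro ⟨⟨A, Y⟩, ⟨z, hz⟩, rfl⟩
    refine ⟨A, Matrix.fromBlocks (z + (2⁻¹ : F) • (A * Yᵀ + Y * Aᵀ)) Y Yᵀ 0, ⟨?_, ?_⟩, ?_⟩
    · have hz' : zᵀ = z := hz
      simp only [Matrix.fromBlocks_transpose, transpose_add, transpose_smul, transpose_mul,
        transpose_transpose, transpose_zero, hz']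
      rw [add_comm (Y * Aᵀ)]
    · intro i j
      rfl
    · rw [key, inv_transpose_Umat, radMat, ← half]
      congr 2
      abel

/-- `R_u^{C,d}` is the central extension of pairs of matrices by symmetric matrices with cocycle
`commForm`. -/
theorem nonempty_centralCoords (hF : (2 : F) ≠ 0) (G : Subgroup (Matrix (κ n d) (κ n d) F)ˣ)
    (hG : ∀ u : (Matrix (κ n d) (κ n d) F)ˣ,
      u ∈ G ↔ (u : Matrix (κ n d) (κ n d) F) ∈ RuC F n d) :
    Nonempty (CentralCoords G (commForm : MatPair F d (n - d) →+ _)) := by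
  have hneg : ∀ (v : MatPair F d (n - d)) z, radMat (-v) (-z) * radMat v z = 1 := fun v z => by
    simpa using radMat_mul_neg hF (-v) (-z)
  let f : MatPair F d (n - d) × symmMat F d → G := fun x =>
    ⟨⟨radMat x.1 x.2, radMat (-x.1) (-x.2), radMat_mul_neg hF _ _, hneg _ _⟩,
      (hG _).2 ((mem_RuC_iff hF _).2 ⟨_, _, rfl⟩)⟩
  have hf : Function.Bijective f := by
    constructor
    · rintro ⟨v, z⟩ ⟨v', z'⟩ h
      obtain ⟨h1, h2⟩ := radMat_injective (congrArg Units.val (congrArg Subtype.val h))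
      exact Prod.ext h1 h2
    · rintro ⟨u, hu⟩
      obtain ⟨v, z, h⟩ := (mem_RuC_iff hF _).1 ((hG u).1 hu)
      exact ⟨(v, z), Subtype.ext (Units.ext h.symm)⟩
  let e := Equiv.ofBijective f hf
  have hmul : ∀ x y, f x * f y = f (x.1 + y.1, x.2 + y.2 + commForm x.1 y.1) := fun x y =>
    Subtype.ext (Units.ext (radMat_mul hF _ _ _ _))
  have hmul' : ∀ g h, e.symm (g * h) = ((e.symm g).1 + (e.symm h).1,
      (e.symm g).2 + (e.symm h).2 + commForm (e.symm g).1 (e.symm h).1) := fun g h => by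
    rw [Equiv.symm_apply_eq]
    refine Eq.trans ?_ (hmul _ _)
    change _ = e (e.symm g) * e (e.symm h)
    rw [e.apply_symm_apply, e.apply_symm_apply]
  exact ⟨{ vec := fun g => (e.symm g).1
           ctr := fun g => (e.symm g).2
           vec_mul := fun g h => by rw [hmul']
           ctr_mul := fun g h => by rw [hmul']
           bijective := e.symm.bijective }⟩

end Radical

theorem exists_symmMat_rank {F : Type} [Field F] {d r : ℕ} (hr : r ≤ d) :
    ∃ B : symmMat F d, B.1.rank = r := by
  classical
  refine ⟨⟨Matrix.diagonal fun i : Fin d => if i.1 < r then 1 else 0,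
    Matrix.isSymm_diagonal _⟩, ?_⟩
  rw [Matrix.rank_diagonal]
  simp only [ne_eq, ite_eq_right_iff, one_ne_zero, imp_false, not_not]
  rw [Fintype.card_subtype]
  rw [Fin.card_filter_val_lt, min_eq_right hr]

/-- The number of irreducible characters of degree `q ^ ((n - d) * r)` in terms of the number of
symmetric matrices of rank `r`. -/
theorem card_characters_RuC {F : Type} [Field F] [Fintype F] (hF : (2 : F) ≠ 0) {n d : ℕ}
    (hdn : d < n) (G : Subgroup (Matrix (κ n d) (κ n d) F)ˣ)
    (hG : ∀ u : (Matrix (κ n d) (κ n d) F)ˣ,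
      u ∈ G ↔ (u : Matrix (κ n d) (κ n d) F) ∈ RuC F n d) {r : ℕ} (hr : r ≤ d) :
    Nat.card {χ : ↥G → ℂ |
          (∃ V : FDRep ℂ ↥G, CategoryTheory.Simple V ∧ FDRep.character V = χ) ∧
          χ 1 = (Fintype.card F : ℂ) ^ ((n - d) * r)} =
      Fintype.card F ^ (2 * d * (n - d) - 2 * ((n - d) * r)) * symmRankCount F (Fin d) r := by
  classical
  obtain ⟨E⟩ := nonempty_centralCoords hF G hG
  have := Fintype.ofFinite G
  obtain ⟨t, rfl⟩ := Nat.exists_eq_add_of_le hr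
  have hexp : 2 * (r + t) * (n - (r + t)) - 2 * ((n - (r + t)) * r) =
      2 * (t * (n - (r + t))) := by
    rw [Nat.sub_eq_iff_eq_add (by nlinarith)]
    ring
  have hD : (Fintype.card F ^ ((n - (r + t)) * r)) ^ 2 *
      Fintype.card F ^ (2 * (t * (n - (r + t)))) = Nat.card (MatPair F (r + t) (n - (r + t))) := by
    rw [card_matPair, ← pow_mul, ← pow_add]
    congr 1
    ring
  have h2 : ∀ w : MatPair F (r + t) (n - (r + t)), ∃ w', w = w' + w' := fun w =>
    ⟨(2⁻¹ : F) • w, by rw [← two_smul F, smul_smul, mul_inv_cancel₀ hF, one_smul]⟩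
  have hmain := E.card_characters commForm_self h2 hD
  rw [Nat.cast_pow] at hmain
  rw [hexp, hmain]
  congr 1
  have hψ := AddChar.FiniteField.primitiveChar_to_Complex_isPrimitive F
  have hone : 1 < Fintype.card F := Fintype.one_lt_card
  let e₁ : {B : Matrix (Fin (r + t)) (Fin (r + t)) F // B.IsSymm ∧ B.rank = r} ≃
      {B : symmMat F (r + t) // B.1.rank = r} :=
    { toFun := fun B => ⟨⟨B.1, B.2.1⟩, B.2.2⟩
      invFun := fun B => ⟨B.1.1, B.1.2, B.2⟩
      left_inv := fun _ => rfl
      right_inv := fun _ => rfl }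
  refine (Nat.card_congr (e₁.trans ((Equiv.ofBijective _ (traceChar_bijective hF hψ)).subtypeEquiv
    fun B => ?_))).symm
  rw [Equiv.ofBijective_apply, card_pairingRadical_traceChar hF hψ,
    (Nat.pow_right_injective hone).eq_iff]
  have hB : B.1.rank ≤ r + t := by simpa using B.1.rank_le_card_width
  constructor
  · intro h
    rw [h, Nat.add_sub_cancel_left]
  · intro h
    have h3 : r + t - B.1.rank = t :=
      Nat.eq_of_mul_eq_mul_right (by omega) (Nat.eq_of_mul_eq_mul_left two_pos h)
    omega

theorem setOf_degrees_RuC {F : Type} [Field F] [Fintype F] (hF : (2 : F) ≠ 0) {n d : ℕ}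
    (G : Subgroup (Matrix (κ n d) (κ n d) F)ˣ)
    (hG : ∀ u : (Matrix (κ n d) (κ n d) F)ˣ,
      u ∈ G ↔ (u : Matrix (κ n d) (κ n d) F) ∈ RuC F n d) :
    {m : ℕ | ∃ V : FDRep ℂ ↥G, CategoryTheory.Simple V ∧ FDRep.character V 1 = (m : ℂ)} =
      {m : ℕ | ∃ r' : ℕ, r' ≤ d ∧ m = Fintype.card F ^ ((n - d) * r')} := by
  classical
  obtain ⟨E⟩ := nonempty_centralCoords hF G hG
  have := Fintype.ofFinite G
  have h2 : ∀ w : MatPair F d (n - d), ∃ w', w = w' + w' := fun w =>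
    ⟨(2⁻¹ : F) • w, by rw [← two_smul F, smul_smul, mul_inv_cancel₀ hF, one_smul]⟩
  have hψ := AddChar.FiniteField.primitiveChar_to_Complex_isPrimitive F
  have hq : 0 < Fintype.card F := Fintype.card_pos
  have hdeg : ∀ (B : symmMat F d) (m : ℕ),
      m ^ 2 * Nat.card (pairingRadical (commForm : MatPair F d (n - d) →+ _)
        (traceChar (AddChar.FiniteField.primitiveChar_to_Complex F) B)) =
          Nat.card (MatPair F d (n - d)) ↔ m = Fintype.card F ^ ((n - d) * B.1.rank) := by
    intro B m
    have hB : B.1.rank ≤ d := by simpa using B.1.rank_le_card_width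
    have hpow : Fintype.card F ^ (2 * (d * (n - d))) =
        (Fintype.card F ^ ((n - d) * B.1.rank)) ^ 2 *
          Fintype.card F ^ (2 * ((d - B.1.rank) * (n - d))) := by
      rw [← pow_mul, ← pow_add]
      congr 1
      obtain ⟨t, ht⟩ := Nat.exists_eq_add_of_le hB
      rw [Nat.sub_eq_of_eq_add' ht]
      nlinarith
    rw [card_pairingRadical_traceChar hF hψ, card_matPair, hpow,
      Nat.mul_left_inj (pow_pos hq _).ne', (Nat.pow_left_injective two_ne_zero).eq_iff]
  ext m
  rw [Set.mem_ofPred_eq, E.exists_simple_character_one_iff commForm_self h2,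
    (traceChar_bijective hF hψ).surjective.exists]
  simp only [hdeg]
  constructor
  · rintro ⟨B, h⟩
    exact ⟨_, by simpa using B.1.rank_le_card_width, h⟩
  · rintro ⟨r, hr, rfl⟩
    obtain ⟨B, hB⟩ := exists_symmMat_rank (F := F) hr
    exact ⟨B, by rw [hB]⟩

/-- the explicit count of irreducible characters of `R_u^{C,d}` of degree
`q^e`, `e = (n−d)r`, and the determination of the set of degrees. -/
theorem ruC_char_count_explicit
    (p k q : ℕ) (hp : p.Prime) (hpodd : Odd p) (hk : 1 ≤ k) (hq : q = p ^ k)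
    (F : Type) [Field F] [Fintype F] (hF : Fintype.card F = q)
    (n d : ℕ) (hd : 1 ≤ d) (hdn : d < n)
    (G : Subgroup (Matrix (κ n d) (κ n d) F)ˣ)
    (hG : ∀ u : (Matrix (κ n d) (κ n d) F)ˣ,
      u ∈ G ↔ (u : Matrix (κ n d) (κ n d) F) ∈ RuC F n d)
    (r e : ℕ) (hr : r ≤ d) (he : e = (n - d) * r) :
    (∀ s : ℕ, r = 2 * s →
      (Nat.card {χ : ↥G → ℂ |
          (∃ V : FDRep ℂ ↥G, CategoryTheory.Simple V ∧ FDRep.character V = χ) ∧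
          χ 1 = (q : ℂ) ^ e} : ℚ) =
        (q : ℚ) ^ (2 * d * (n - d) - 2 * e) *
          (∏ i ∈ Finset.Icc 1 s, ((q : ℚ) ^ (2 * i) / ((q : ℚ) ^ (2 * i) - 1))) *
            ∏ i ∈ Finset.range (2 * s), ((q : ℚ) ^ (d - i) - 1)) ∧
    (∀ s : ℕ, r = 2 * s + 1 →
      (Nat.card {χ : ↥G → ℂ |
          (∃ V : FDRep ℂ ↥G, CategoryTheory.Simple V ∧ FDRep.character V = χ) ∧
          χ 1 = (q : ℂ) ^ e} : ℚ) =
        (q : ℚ) ^ (2 * d * (n - d) - 2 * e) *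
          (∏ i ∈ Finset.Icc 1 s, ((q : ℚ) ^ (2 * i) / ((q : ℚ) ^ (2 * i) - 1))) *
            ∏ i ∈ Finset.range (2 * s + 1), ((q : ℚ) ^ (d - i) - 1)) ∧
    {m : ℕ | ∃ V : FDRep ℂ ↥G, CategoryTheory.Simple V ∧ FDRep.character V 1 = (m : ℂ)} =
      {m : ℕ | ∃ r' : ℕ, r' ≤ d ∧ m = q ^ ((n - d) * r')} := by
  have hF2 : (2 : F) ≠ 0 := by
    intro h
    have h2 : CharP F 2 := CharTwo.of_one_ne_zero_of_two_eq_zero one_ne_zero h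
    obtain ⟨m, hm⟩ := FiniteField.card F 2
    have hodd : Odd (2 ^ (m : ℕ)) := by
      rw [← hm.2, hF, hq]
      exact hpodd.pow
    rw [Nat.odd_pow_iff m.pos.ne'] at hodd
    exact absurd hodd (by decide)
  subst hF he
  have hcount := card_characters_RuC hF2 hdn G hG hr
  refine ⟨?_, ?_, setOf_degrees_RuC hF2 G hG⟩
  · rintro s rfl
    rw [hcount, Nat.cast_mul, symmRankCount_fin_two_mul F hr, Nat.cast_pow, ← mul_assoc]
  · rintro s rfl
    rw [hcount, Nat.cast_mul, symmRankCount_fin_two_mul_add_one F hr, Nat.cast_pow, ← mul_assoc]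

end SpUnipotentRadical
end
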